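/- arXiv:1712.03180 — 3 statements merged into one kernel-verified Lean document; each statement's English description precedes it below -/
import Mathlib

section
/- If a quasi-simplicial map p: K → L between polyhedra is surjective and n-regular, then the pull-back p^{-1}(ℬ_L) of the cover of L by barycentric stars of vertices is an AE(n)-cover of K. -/
open Set Metric unitInterval
open scoped ENNReal Classical

noncomputable section

/-! ### Basic extension-theoretic notions -/

/-- A topological space has covering dimension `< n` (order of refinements at most `n`):
every open cover admits an open refinement in which every point belongs to
at most `n` members. -/
def CovDimLT (X : Type*) [TopologicalSpace X] (n : ℕ) : Prop :=
  ∀ U : Set (Set X), (∀ u ∈ U, IsOpen u) → ⋃₀ U = univ →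
    ∃ R : Set (Set X), (∀ r ∈ R, IsOpen r) ∧ ⋃₀ R = univ ∧
      (∀ r ∈ R, ∃ u ∈ U, r ⊆ u) ∧
      ∀ x : X, {r ∈ R | x ∈ r}.Finite ∧ {r ∈ R | x ∈ r}.ncard ≤ n

/-- Lebesgue covering dimension at most `n`. -/
def CovDimLE (X : Type*) [TopologicalSpace X] (n : ℕ) : Prop :=
  CovDimLT X (n + 1)

/-- `X` is an absolute extensor in dimension `n` (an `AE(n)`): every continuous map into `X`
from a closed subset of an at most `n`-dimensional metric space `Y` extends continuously
over all of `Y`. -/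
def IsAE.{u, v} (n : ℕ) (X : Type v) [TopologicalSpace X] : Prop :=
  ∀ (Y : Type u) [MetricSpace Y], CovDimLE Y n →
    ∀ A : Set Y, IsClosed A → ∀ f : C(A, X),
      ∃ g : C(Y, X), ∀ a : A, g ↑a = f a

/-- `X` is an absolute neighborhood extensor in dimension `n` (an `ANE(n)`): every continuous
map into `X` from a closed subset `A` of an at most `n`-dimensional metric space extends
continuously over some open neighborhood of `A`. -/
def IsANE.{u, v} (n : ℕ) (X : Type v) [TopologicalSpace X] : Prop :=
  ∀ (Y : Type u) [MetricSpace Y], CovDimLE Y n →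
    ∀ A : Set Y, IsClosed A → ∀ f : C(A, X),
      ∃ (U : Set Y) (_ : IsOpen U) (hAU : A ⊆ U) (g : C(U, X)),
        ∀ (a : Y) (ha : a ∈ A), g ⟨a, hAU ha⟩ = f ⟨a, ha⟩

/-- `X` is an `ANE(∞)`: an absolute neighborhood extensor for the class of all metric
spaces (no dimension restriction). -/
def IsANEInf.{u, v} (X : Type v) [TopologicalSpace X] : Prop :=
  ∀ (Y : Type u) [MetricSpace Y],
    ∀ A : Set Y, IsClosed A → ∀ f : C(A, X),
      ∃ (U : Set Y) (_ : IsOpen U) (hAU : A ⊆ U) (g : C(U, X)),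
        ∀ (a : Y) (ha : a ∈ A), g ⟨a, hAU ha⟩ = f ⟨a, ha⟩

/-! ### Covers -/

/-- An (indexed) family is a cover when its union is everything. -/
def IsCover {ι X : Type*} (F : ι → Set X) : Prop :=
  (⋃ i, F i) = univ

/-- A cover is an `AE(n)`-cover if the intersection of every (nonempty) subfamily is either
empty or an absolute extensor in dimension `n`. -/
def IsAECover.{u, v, w} (n : ℕ) {ι : Type v} {X : Type w} [TopologicalSpace X]
    (F : ι → Set X) : Prop :=
  IsCover F ∧ ∀ A : Set ι, A.Nonempty →
    (⋂ i ∈ A, F i) = ∅ ∨ IsAE.{u} n (⋂ i ∈ A, F i)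

/-- Two covers with the same indexing set are isomorphic if corresponding subfamilies
have nonempty intersections simultaneously. -/
def CoversIsomorphic {ι X Y : Type*} (F : ι → Set X) (G : ι → Set Y) : Prop :=
  ∀ J : Set ι, (⋂ i ∈ J, F i).Nonempty ↔ (⋂ i ∈ J, G i).Nonempty

/-- A cover is locally finite-dimensional if its nerve is a locally finite-dimensional
simplicial complex: every vertex belongs to simplices of bounded dimension only. -/
def LocallyFinDimCover {ι X : Type*} (F : ι → Set X) : Prop :=
  ∀ i : ι, ∃ N : ℕ, ∀ A : Finset ι, i ∈ A → (⋂ j ∈ A, F j).Nonempty → A.card ≤ N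

/-- Two maps are `F`-close when each pair of corresponding values lies in a common
element of `F`. -/
def CoverClose {ι X Y : Type*} (F : ι → Set Y) (f g : X → Y) : Prop :=
  ∀ x : X, ∃ i : ι, f x ∈ F i ∧ g x ∈ F i

/-- Two maps are `F`-homotopic when they are joined by a homotopy each of whose paths
lies in a single element of `F`. -/
def CoverHomotopic {ι X Y : Type*} [TopologicalSpace X] [TopologicalSpace Y]
    (F : ι → Set Y) (f g : C(X, Y)) : Prop :=
  ∃ H : f.Homotopy g, ∀ x : X, ∃ i : ι, ∀ t : unitInterval, H (t, x) ∈ F i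

/-- The mesh of a cover: the supremum of the diameters of its elements. -/
def coverMesh {ι X : Type*} [PseudoEMetricSpace X] (F : ι → Set X) : ℝ≥0∞ :=
  ⨆ i, EMetric.diam (F i)

/-! ### Homotopy-theoretic notions -/

/-- The function induced by a continuous map on homotopy groups (of index type `N`). -/
def HomotopyGroup.inducedMap {X Y : Type*} [TopologicalSpace X] [TopologicalSpace Y]
    (f : C(X, Y)) (N : Type*) (x : X) :
    HomotopyGroup N X x → HomotopyGroup N Y (f x) :=
  Quotient.map
    (fun g => ⟨f.comp g.1, fun y hy => by
      simp only [ContinuousMap.comp_apply]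
      rw [g.2 y hy]⟩)
    (fun g h H => H.elim fun H => ⟨H.compContinuousMap f⟩)

/-- A continuous map is a weak `n`-homotopy equivalence if it induces isomorphisms on
homotopy groups in all dimensions `< n`, regardless of the choice of basepoint. -/
def IsWeakNHomotopyEquiv {X Y : Type*} [TopologicalSpace X] [TopologicalSpace Y]
    (n : ℕ) (f : C(X, Y)) : Prop :=
  ∀ k < n, ∀ x : X, Function.Bijective (HomotopyGroup.inducedMap f (Fin k) x)

/-- `X` has vanishing homotopy groups in all dimensions `< n`, for every basepoint. -/
def VanishingHomotopyBelow (n : ℕ) (X : Type*) [TopologicalSpace X] : Prop :=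
  ∀ k < n, ∀ x : X, Subsingleton (HomotopyGroup (Fin k) X x)

/-- `f` is null-homotopic inside the subset `U`: there is a homotopy, with values in `U`,
from `f` to a constant map. -/
def NullHomotopicIn {S X : Type*} [TopologicalSpace S] [TopologicalSpace X]
    (f : C(S, X)) (U : Set X) : Prop :=
  ∃ (H : C(S × unitInterval, X)) (c : X),
    (∀ s : S, H (s, 0) = f s) ∧ (∀ s : S, H (s, 1) = c) ∧ ∀ z, H z ∈ U

/-- `X` is locally `k`-connected: every neighborhood `U` of a point contains a
neighborhood `V` of the point such that every map of the `k`-sphere into `V` is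
null-homotopic in `U`. -/
def LocallyKConnected (k : ℕ) (X : Type*) [TopologicalSpace X] : Prop :=
  ∀ (x : X) (U : Set X), IsOpen U → x ∈ U →
    ∃ V : Set X, IsOpen V ∧ x ∈ V ∧
      ∀ f : C(Metric.sphere (0 : EuclideanSpace ℝ (Fin (k + 1))) 1, X),
        (∀ s, f s ∈ V) → NullHomotopicIn f U

/-- `A` is a deformation retract of `B` (both subsets of an ambient space `X`). -/
def IsDeformationRetractOf {X : Type*} [TopologicalSpace X] (A B : Set X) : Prop :=
  A ⊆ B ∧ ∃ H : C(B × unitInterval, X),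
    (∀ b : B, H (b, 0) = ↑b) ∧ (∀ b : B, H (b, 1) ∈ A) ∧
    (∀ (b : B) (t : unitInterval), H (b, t) ∈ B) ∧
    ∀ b : B, (b : X) ∈ A → H (b, 1) = ↑b

/-! ### Simplicial complexes and their metric realizations -/

/-- An abstract simplicial complex on a vertex type `V`. -/
structure SComplex (V : Type*) where
  faces : Set (Finset V)
  nonempty_of_mem : ∀ s ∈ faces, s.Nonempty
  down_closed : ∀ s ∈ faces, ∀ t : Finset V, t ⊆ s → t.Nonempty → t ∈ faces

namespace SComplex

variable {V W : Type*}

/-- The geometric realization with scale `κ` of a simplicial complex, i.e. the polyhedron,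
as a subset of `ℓ¹(V)`: nonnegative functions supported on a simplex whose coordinates sum
to `κ` (each vertex `v` is the point `κ·e_v`).  It carries the metric topology induced from
the `ℓ¹`-norm. -/
def space (K : SComplex V) (κ : ℝ) : Set (lp (fun _ : V => ℝ) 1) :=
  {x | (∀ v, 0 ≤ x v) ∧ (∃ s ∈ K.faces, ∀ v, x v ≠ 0 → v ∈ s) ∧
    HasSum (fun v => x v) κ}

/-- The closed geometric simplex of the realization spanned by a face `s`. -/
def cell (K : SComplex V) (κ : ℝ) (s : Finset V) : Set (K.space κ) :=
  {x | ∀ v, (x : lp (fun _ : V => ℝ) 1) v ≠ 0 → v ∈ s}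

/-- The simplices of the barycentric subdivision `βK` are the nonempty finite chains
of faces of `K`. -/
def IsChainOfFaces (K : SComplex V) (c : Finset (Finset V)) : Prop :=
  c.Nonempty ∧ (∀ s ∈ c, s ∈ K.faces) ∧ ∀ s₁ ∈ c, ∀ s₂ ∈ c, s₁ ⊆ s₂ ∨ s₂ ⊆ s₁

/-- The closed geometric simplex of the barycentric subdivision `βK` spanned by the chain
`c`, viewed inside the realization of `K`: the convex hull of the barycenters of the
faces in `c`. -/
def chainCell (K : SComplex V) (κ : ℝ) (c : Finset (Finset V)) : Set (K.space κ) :=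
  {y | ∃ t : Finset V → ℝ, (∀ s, 0 ≤ t s) ∧ (∀ s, t s ≠ 0 → s ∈ c) ∧
      (∑ s ∈ c, t s) = κ ∧
      ∀ w, (y : lp (fun _ : V => ℝ) 1) w =
        ∑ s ∈ c, (if w ∈ s then t s / (s.card : ℝ) else 0)}

/-- A set of faces forms a subcomplex of `K`. -/
def IsSubcomplex (K : SComplex V) (F : Set (Finset V)) : Prop :=
  F ⊆ K.faces ∧ ∀ s ∈ F, ∀ t : Finset V, t ⊆ s → t.Nonempty → t ∈ F

/-- The point set of the subcomplex with faces `F`, inside the realization of `K`. -/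
def subSpace (K : SComplex V) (κ : ℝ) (F : Set (Finset V)) : Set (K.space κ) :=
  {x | ∃ s ∈ F, ∀ v, (x : lp (fun _ : V => ℝ) 1) v ≠ 0 → v ∈ s}

/-- The barycentric star of a subcomplex `F` in `K`: the union of the simplices of the
barycentric subdivision `βK` that intersect the subcomplex. -/
def bst (K : SComplex V) (κ : ℝ) (F : Set (Finset V)) : Set (K.space κ) :=
  ⋃ c ∈ {c | K.IsChainOfFaces c ∧ (K.chainCell κ c ∩ K.subSpace κ F).Nonempty},
    K.chainCell κ c

/-- The open star of a subcomplex `F` in `K`: the complement of the union of all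
simplices of `K` that do not intersect the subcomplex. -/
def ost (K : SComplex V) (κ : ℝ) (F : Set (Finset V)) : Set (K.space κ) :=
  (⋃ s ∈ {s | s ∈ K.faces ∧ K.cell κ s ∩ K.subSpace κ F = ∅}, K.cell κ s)ᶜ

/-- The open star of a subcomplex `F` taken in the barycentric subdivision `βK`:
the complement of the union of all simplices of `βK` that do not intersect the
subcomplex. -/
def ostBsd (K : SComplex V) (κ : ℝ) (F : Set (Finset V)) : Set (K.space κ) :=
  (⋃ c ∈ {c | K.IsChainOfFaces c ∧ K.chainCell κ c ∩ K.subSpace κ F = ∅},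
    K.chainCell κ c)ᶜ

/-- Barycentric star of a vertex. -/
def bstVertex (K : SComplex V) (κ : ℝ) (v : V) : Set (K.space κ) :=
  K.bst κ {({v} : Finset V)}

/-- Open star of a vertex. -/
def ostVertex (K : SComplex V) (κ : ℝ) (v : V) : Set (K.space κ) :=
  K.ost κ {({v} : Finset V)}

/-- A simplicial complex is locally finite-dimensional if the simplices containing any
given vertex have bounded dimension. -/
def LocallyFiniteDimensional (K : SComplex V) : Prop :=
  ∀ v : V, {v} ∈ K.faces → ∃ N : ℕ, ∀ s ∈ K.faces, v ∈ s → s.card ≤ N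

/-- `p` is a simplicial map of the realizations (scales `κ`, `lam`): it is induced by a
vertex map `φ` carrying faces onto faces, extended affinely on each simplex. -/
def IsSimplicialMap (K : SComplex V) (L : SComplex W) (κ lam : ℝ)
    (p : K.space κ → L.space lam) : Prop :=
  ∃ φ : V → W,
    (∀ s ∈ K.faces, ∃ t ∈ L.faces,
      (∀ v ∈ s, φ v ∈ t) ∧ ∀ w ∈ t, ∃ v ∈ s, φ v = w) ∧
    ∀ (x : K.space κ) (w : W),
      (p x : lp (fun _ : W => ℝ) 1) w =
        (lam / κ) * ∑' v : V, (if φ v = w then (x : lp (fun _ : V => ℝ) 1) v else 0)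

/-- `p` is quasi-simplicial: it is simplicial as a map into the barycentric subdivision
`βL`, i.e. induced by a vertex map `φ` from vertices of `K` to faces of `L` (the vertices
of `βL`) carrying each face of `K` into a chain, extended affinely; the formula is the
composition of the simplicial extension with the canonical identification `|βL| = |L|`
sending the vertex `s` of `βL` to the barycenter of `s`. -/
def IsQuasiSimplicialMap (K : SComplex V) (L : SComplex W) (κ lam : ℝ)
    (p : K.space κ → L.space lam) : Prop :=
  ∃ φ : V → Finset W,
    (∀ v : V, ({v} : Finset V) ∈ K.faces → φ v ∈ L.faces) ∧
    (∀ s ∈ K.faces, ∀ v₁ ∈ s, ∀ v₂ ∈ s, φ v₁ ⊆ φ v₂ ∨ φ v₂ ⊆ φ v₁) ∧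
    ∀ (x : K.space κ) (w : W),
      (p x : lp (fun _ : W => ℝ) 1) w =
        (lam / κ) *
          ∑' v : V, (if w ∈ φ v then (x : lp (fun _ : V => ℝ) 1) v / ((φ v).card : ℝ)
            else 0)

/-- A quasi-simplicial map is `n`-regular if the preimage of every (closed) simplex of
the barycentric subdivision `βL` has vanishing homotopy groups in dimensions `< n`,
regardless of basepoint. -/
def IsNRegularMap (n : ℕ) (K : SComplex V) (L : SComplex W) (κ lam : ℝ)
    (p : K.space κ → L.space lam) : Prop :=
  IsQuasiSimplicialMap K L κ lam p ∧
    ∀ c : Finset (Finset W), L.IsChainOfFaces c →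
      VanishingHomotopyBelow n (p ⁻¹' (L.chainCell lam c))

end SComplex

/-! ### Inverse limits -/

/-- The long projection of an inverse limit (realized as the subspace of the product
consisting of all threads) onto its `i`-th coordinate space. -/
def invLimProj {Z : ℕ → Type*} [∀ i, TopologicalSpace (Z i)]
    (p : ∀ i, C(Z (i + 1), Z i)) (i : ℕ) :
    C({x : ∀ j, Z j // ∀ j, p j (x (j + 1)) = x j}, Z i) :=
  ⟨fun x => x.1 i, (continuous_apply i).comp continuous_subtype_val⟩

/-- The short projections of an inverse sequence: `shortProj p i m : Z (i + m) → Z i`. -/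
def shortProj {Z : ℕ → Type*} [∀ i, TopologicalSpace (Z i)]
    (p : ∀ i, C(Z (i + 1), Z i)) (i : ℕ) : ∀ m : ℕ, C(Z (i + m), Z i)
  | 0 => ContinuousMap.id _
  | m + 1 => (shortProj p i m).comp (p (i + m))

end

universe u


section sphere

noncomputable def qMap (k : ℕ) (z : Fin k → I) : WithLp 2 ((Fin k → ℝ) × ℝ) :=
  WithLp.toLp 2 ((2 * Real.sqrt (1 - ‖fun i => 2 * (z i : ℝ) - 1‖ ^ 2)) • (fun i => 2 * (z i : ℝ) - 1),
    2 * ‖fun i => 2 * (z i : ℝ) - 1‖ ^ 2 - 1)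

theorem qMap_cont (k : ℕ) : Continuous (qMap k) := by
  unfold qMap
  fun_prop

theorem qr_le (k : ℕ) (z : Fin k → I) : ‖fun i => 2 * (z i : ℝ) - 1‖ ≤ 1 := by
  rw [pi_norm_le_iff_of_nonneg zero_le_one]
  intro i
  have h1 := (z i).2.1
  have h2 := (z i).2.2
  rw [Real.norm_eq_abs, abs_le]
  constructor <;> linarith

theorem qr_bd (k : ℕ) (z : Fin k → I) (h : ‖fun i => 2 * (z i : ℝ) - 1‖ = 1) :
    z ∈ Cube.boundary (Fin k) := by
  have : ∃ i, ‖2 * (z i : ℝ) - 1‖ = 1 := by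
    by_contra hc
    push Not at hc
    have hlt : ‖fun i => 2 * (z i : ℝ) - 1‖ < 1 := by
      rw [pi_norm_lt_iff zero_lt_one]
      intro i
      exact lt_of_le_of_ne ((norm_le_pi_norm (fun i => 2 * (z i : ℝ) - 1) i).trans (qr_le k z)) (hc i)
    linarith
  obtain ⟨i, hi⟩ := this
  refine ⟨i, ?_⟩
  rw [Real.norm_eq_abs, abs_eq zero_le_one] at hi
  rcases hi with hi | hi
  · right; apply Subtype.ext; rw [Set.Icc.coe_one]; linarith
  · left; apply Subtype.ext; rw [Set.Icc.coe_zero]; linarith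

theorem bd_qr (k : ℕ) (z : Fin k → I) (h : z ∈ Cube.boundary (Fin k)) :
    ‖fun i => 2 * (z i : ℝ) - 1‖ = 1 := by
  obtain ⟨i, hi⟩ := h
  refine le_antisymm (qr_le k z) ?_
  refine le_trans ?_ (norm_le_pi_norm (fun i => 2 * (z i : ℝ) - 1) i)
  rcases hi with hi | hi <;> (simp [hi]; try norm_num)

theorem qMap_bd (k : ℕ) (z : Fin k → I) (h : z ∈ Cube.boundary (Fin k)) :
    qMap k z = WithLp.toLp 2 (0, 1) := by
  unfold qMap
  rw [bd_qr k z h]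
  norm_num

theorem qMap_norm (k : ℕ) (z : Fin k → I) : ‖qMap k z‖ = 1 := by
  have h := WithLp.prod_norm_sq_eq_of_L2 (qMap k z)
  have hr := qr_le k z
  have hr0 := norm_nonneg (fun i => 2 * (z i : ℝ) - 1)
  unfold qMap at h ⊢
  set x : Fin k → ℝ := fun i => 2 * (z i : ℝ) - 1
  have hs := Real.sq_sqrt (show 0 ≤ 1 - ‖x‖^2 by nlinarith)
  have : ‖WithLp.toLp 2 ((2 * Real.sqrt (1 - ‖x‖^2)) • x, 2 * ‖x‖^2 - 1)‖^2 = 1 := by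
    rw [h]
    change ‖(2 * Real.sqrt (1 - ‖x‖^2)) • x‖ ^ 2 + ‖2 * ‖x‖^2 - 1‖ ^ 2 = 1
    rw [norm_smul, Real.norm_eq_abs, Real.norm_eq_abs, mul_pow, sq_abs, sq_abs, mul_pow, hs]; ring
  rw [← sq_eq_sq₀ (norm_nonneg _) zero_le_one, this]; norm_num

theorem qMap_inj (k : ℕ) (z z' : Fin k → I) (h : qMap k z = qMap k z') :
    z = z' ∨ (z ∈ Cube.boundary (Fin k) ∧ z' ∈ Cube.boundary (Fin k)) := by
  have hr := qr_le k z
  have hr0 := norm_nonneg (fun i => 2 * (z i : ℝ) - 1)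
  have hr' := qr_le k z'
  have hr0' := norm_nonneg (fun i => 2 * (z' i : ℝ) - 1)
  unfold qMap at h
  have h1 := congrArg (fun e => (WithLp.ofLp e).1) h
  have h2 := congrArg (fun e => (WithLp.ofLp e).2) h
  simp only at h1 h2
  have e : ‖fun i => 2 * (z i : ℝ) - 1‖ = ‖fun i => 2 * (z' i : ℝ) - 1‖ := by
    rw [← sq_eq_sq₀ hr0 hr0']; linarith
  by_cases hb : ‖fun i => 2 * (z i : ℝ) - 1‖ = 1
  · right; exact ⟨qr_bd k z hb, qr_bd k z' (e ▸ hb)⟩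
  · left
    rw [← e] at h1
    have hpos : 0 < 2 * Real.sqrt (1 - ‖fun i => 2 * (z i : ℝ) - 1‖ ^ 2) := by
      have : ‖fun i => 2 * (z i : ℝ) - 1‖ < 1 := lt_of_le_of_ne hr hb
      have : 0 < 1 - ‖fun i => 2 * (z i : ℝ) - 1‖ ^ 2 := by nlinarith
      positivity
    have h3 := smul_right_injective _ hpos.ne' h1
    ext i
    have := congrFun h3 i
    linarith

theorem cube_of_norm (k : ℕ) (x : Fin k → ℝ) (hx : ‖x‖ ≤ 1) :
    ∃ z : Fin k → I, (fun i => 2 * (z i : ℝ) - 1) = x := by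
  rw [pi_norm_le_iff_of_nonneg zero_le_one] at hx
  refine ⟨fun i => ⟨(x i + 1) / 2, ?_⟩, ?_⟩
  · have := hx i
    rw [Real.norm_eq_abs, abs_le] at this
    constructor <;> linarith
  · ext i; simp only; ring

theorem qMap_surj (k : ℕ) (hk : 0 < k) (d : WithLp 2 ((Fin k → ℝ) × ℝ)) (hd : ‖d‖ = 1) :
    ∃ z, qMap k z = d := by
  have h := WithLp.prod_norm_sq_eq_of_L2 d
  rw [hd] at h
  have hd' : d = WithLp.toLp 2 (d.fst, d.snd) := rfl
  set w := d.fst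
  set s := d.snd
  rw [Real.norm_eq_abs, sq_abs] at h
  have hw := sq_nonneg ‖w‖
  have hs1 : s ≤ 1 := by nlinarith
  have hs2 : -1 ≤ s := by nlinarith
  rcases eq_or_lt_of_le hs1 with hs | hs
  · have hw0 : w = 0 := by
      rw [hs] at h
      have : ‖w‖ ^ 2 = 0 := by linarith
      simpa using this
    refine ⟨fun _ => 1, ?_⟩
    rw [qMap_bd k _ ⟨⟨0, hk⟩, Or.inr rfl⟩, hd', hw0, hs]
  · set c := Real.sqrt ((1 - s) / 2)
    have hc : 0 < c := Real.sqrt_pos.2 (by linarith)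
    have hc2 : c ^ 2 = (1 - s) / 2 := Real.sq_sqrt (by linarith)
    have hx2 : ‖(1 / (2 * c)) • w‖ ^ 2 = (1 + s) / 2 := by
      rw [norm_smul, mul_pow, Real.norm_eq_abs, sq_abs, div_pow, mul_pow, hc2]
      have : (1 - s) ≠ 0 := by linarith
      field_simp
      nlinarith
    obtain ⟨z, hz⟩ := cube_of_norm k ((1 / (2 * c)) • w) (by
      rw [← sq_le_sq₀ (norm_nonneg _) zero_le_one, hx2]; linarith)
    refine ⟨z, ?_⟩
    unfold qMap
    rw [hz, hx2, hd']
    congr 2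
    · rw [smul_smul, show 1 - (1 + s) / 2 = (1 - s) / 2 by ring]
      change (2 * c * (1 / (2 * c))) • w = w
      rw [mul_one_div_cancel (by positivity), one_smul]
    · ring

theorem sphere_ext {X : Type*} [TopologicalSpace X] (k : ℕ) (hk : 0 < k)
    (hX : ∀ x : X, Subsingleton (HomotopyGroup (Fin k) X x))
    (f : WithLp 2 ((Fin k → ℝ) × ℝ) → X) (hf : ContinuousOn f (sphere 0 1)) :
    ∃ F : WithLp 2 ((Fin k → ℝ) × ℝ) → X, ContinuousOn F (closedBall 0 1) ∧
      EqOn F f (sphere 0 1) := by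
  let x0 : X := f (WithLp.toLp 2 (0, 1))
  have hfq : Continuous (fun z => f (qMap k z)) :=
    hf.comp_continuous (qMap_cont k) (fun z => by simp [qMap_norm])
  let γ : GenLoop (Fin k) X x0 := ⟨⟨_, hfq⟩, fun z hz => by
    simp only [ContinuousMap.coe_mk]; rw [qMap_bd k z hz]⟩
  have hhom : GenLoop.Homotopic γ GenLoop.const := by
    have := hX x0
    exact Quotient.exact (Subsingleton.elim (α := HomotopyGroup (Fin k) X x0) ⟦γ⟧ ⟦GenLoop.const⟧)
  obtain ⟨H⟩ := hhom
  let Q : C(I × (Fin k → I), closedBall (0 : WithLp 2 ((Fin k → ℝ) × ℝ)) 1) :=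
    ⟨fun p => ⟨(1 - (p.1 : ℝ)) • qMap k p.2, by
      rw [mem_closedBall_zero_iff, norm_smul, qMap_norm, mul_one, Real.norm_eq_abs,
        abs_of_nonneg (by linarith [p.1.2.2])]
      linarith [p.1.2.1]⟩, by
      have := qMap_cont k
      fun_prop⟩
  have hQs : Function.Surjective Q := by
    rintro ⟨d, hd⟩
    rw [mem_closedBall_zero_iff] at hd
    by_cases h0 : d = 0
    · refine ⟨(1, fun _ => 0), ?_⟩
      ext1; simp [Q, h0]
    · have hn : ‖d‖ ≠ 0 := by simpa using h0
      obtain ⟨z, hz⟩ := qMap_surj k hk (‖d‖⁻¹ • d) (by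
        rw [norm_smul, norm_inv, norm_norm, inv_mul_cancel₀ hn])
      refine ⟨(⟨1 - ‖d‖, by linarith, by linarith [norm_nonneg d]⟩, z), ?_⟩
      ext1
      simp only [Q, ContinuousMap.coe_mk, hz]
      rw [smul_smul]; simp [hn]
  have hQ : Topology.IsQuotientMap Q :=
    (Q.continuous.isClosedMap).isQuotientMap Q.continuous hQs
  have hcomp : ∀ a b, Q a = Q b → H.toContinuousMap a = H.toContinuousMap b := by
    rintro ⟨t, z⟩ ⟨t', z'⟩ hab
    have h1 : (1 - (t : ℝ)) • qMap k z = (1 - (t' : ℝ)) • qMap k z' := congrArg Subtype.val hab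
    have hn := congrArg norm h1
    rw [norm_smul, norm_smul, qMap_norm, qMap_norm, mul_one, mul_one, Real.norm_eq_abs,
      Real.norm_eq_abs, abs_of_nonneg (by linarith [t.2.2]), abs_of_nonneg (by linarith [t'.2.2])] at hn
    have htt : t = t' := by ext; linarith
    subst htt
    change H (t, z) = H (t, z')
    by_cases ht : t = 1
    · subst ht
      rw [H.apply_one, H.apply_one]; rfl
    · have : (1 - (t : ℝ)) ≠ 0 := by
        intro h; apply ht; apply Subtype.ext; rw [Set.Icc.coe_one]; linarith
      have h2 := smul_right_injective _ this h1
      rcases qMap_inj k z z' h2 with rfl | ⟨hz, hz'⟩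
      · rfl
      · rw [H.eq_fst t hz, H.eq_fst t hz', γ.2 z hz, γ.2 z' hz']
  let F0 := hQ.lift H.toContinuousMap hcomp
  have hF0 : ∀ a, F0 (Q a) = H a := fun a => by
    have := hQ.lift_comp H.toContinuousMap hcomp
    exact congrArg (fun g => g a) this
  refine ⟨fun d => if h : d ∈ closedBall 0 1 then F0 ⟨d, h⟩ else x0, ?_, ?_⟩
  · rw [continuousOn_iff_continuous_domRestrict]
    refine F0.continuous.congr fun d => ?_
    rw [domRestrict_apply, dif_pos d.2]
  · intro d hd
    rw [mem_sphere_zero_iff_norm] at hd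
    obtain ⟨z, rfl⟩ := qMap_surj k hk d hd
    have hm : qMap k z ∈ closedBall (0 : WithLp 2 ((Fin k → ℝ) × ℝ)) 1 := by
      rw [mem_closedBall_zero_iff, hd]
    simp only [dif_pos hm]
    have : Q (0, z) = ⟨qMap k z, hm⟩ := by ext1; simp [Q]
    rw [← this, hF0, H.apply_zero]; rfl

end sphere


section simplex

noncomputable def psi0 (k : ℕ) (d : WithLp 2 ((Fin k → ℝ) × ℝ)) : Fin (k + 2) → ℝ :=
  Fin.cons (1 - ∑ i, d.fst i - d.snd) (Fin.cons d.snd d.fst : Fin (k + 1) → ℝ)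

def phi0 (k : ℕ) (u : Fin (k + 2) → ℝ) : WithLp 2 ((Fin k → ℝ) × ℝ) :=
  WithLp.toLp 2 (fun i => u i.succ.succ, u 1)

theorem psi0_cont (k : ℕ) : Continuous (psi0 k) := by
  unfold psi0
  refine continuous_pi fun j => ?_
  refine Fin.cases ?_ (fun j => ?_) j
  · simp only [Fin.cons_zero]
    fun_prop
  · simp only [Fin.cons_succ]
    refine Fin.cases ?_ (fun j => ?_) j
    · simp only [Fin.cons_zero]; fun_prop
    · simp only [Fin.cons_succ]; fun_prop

theorem phi0_cont (k : ℕ) : Continuous (phi0 k) := by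
  unfold phi0
  fun_prop

theorem psi0_phi0 (k : ℕ) (u : Fin (k + 2) → ℝ) (hu : ∑ i, u i = 1) : psi0 k (phi0 k u) = u := by
  rw [Fin.sum_univ_succ, Fin.sum_univ_succ] at hu
  funext j
  refine Fin.cases ?_ (fun j => ?_) j
  · simp only [psi0, phi0, Fin.cons_zero, WithLp.toLp_fst, WithLp.toLp_snd]
    have : u (Fin.succ 0) = u 1 := rfl
    rw [this] at hu
    linarith
  · simp only [psi0, phi0, Fin.cons_succ]
    refine Fin.cases ?_ (fun j => ?_) j
    · simp
    · simp

def DSimp (k : ℕ) : Set (WithLp 2 ((Fin k → ℝ) × ℝ)) :=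
  {d | (∀ i, 0 ≤ d.fst i) ∧ 0 ≤ d.snd ∧ ∑ i, d.fst i + d.snd ≤ 1}

theorem DSimp_convex (k : ℕ) : Convex ℝ (DSimp k) := by
  rintro d ⟨h1, h2, h3⟩ d' ⟨h1', h2', h3'⟩ a b ha hb hab
  refine ⟨fun i => ?_, ?_, ?_⟩
  · have := h1 i; have := h1' i
    simp only [WithLp.add_fst, WithLp.smul_fst, Pi.add_apply, Pi.smul_apply, smul_eq_mul]
    positivity
  · simp only [WithLp.add_snd, WithLp.smul_snd, smul_eq_mul]
    positivity
  · simp only [WithLp.add_fst, WithLp.smul_fst, Pi.add_apply, Pi.smul_apply, smul_eq_mul,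
      WithLp.add_snd, WithLp.smul_snd, Finset.sum_add_distrib, ← Finset.mul_sum]
    calc _ = a * (∑ i, d.fst i + d.snd) + b * (∑ i, d'.fst i + d'.snd) := by ring
      _ ≤ a * 1 + b * 1 := by gcongr
      _ = 1 := by linarith

theorem DSimp_closed (k : ℕ) : IsClosed (DSimp k) := by
  have : DSimp k = (⋂ i, {d | 0 ≤ d.fst i}) ∩ ({d | 0 ≤ d.snd} ∩ {d | ∑ i, d.fst i + d.snd ≤ 1}) := by
    ext d; simp [DSimp]
  rw [this]
  refine (isClosed_iInter fun i => ?_).inter (IsClosed.inter ?_ ?_)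
  · exact isClosed_le continuous_const (by fun_prop)
  · exact isClosed_le continuous_const (by fun_prop)
  · exact isClosed_le (by fun_prop) continuous_const

def USimp (k : ℕ) : Set (WithLp 2 ((Fin k → ℝ) × ℝ)) :=
  {d | (∀ i, 0 < d.fst i) ∧ 0 < d.snd ∧ ∑ i, d.fst i + d.snd < 1}

theorem USimp_open (k : ℕ) : IsOpen (USimp k) := by
  have : USimp k = (⋂ i, {d | 0 < d.fst i}) ∩ ({d | 0 < d.snd} ∩ {d | ∑ i, d.fst i + d.snd < 1}) := by
    ext d; simp [USimp]
  rw [this]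
  refine (isOpen_iInter_of_finite fun i => ?_).inter (IsOpen.inter ?_ ?_)
  · exact isOpen_lt continuous_const (by fun_prop)
  · exact isOpen_lt continuous_const (by fun_prop)
  · exact isOpen_lt (by fun_prop) continuous_const

theorem DSimp_interior (k : ℕ) : interior (DSimp k) = USimp k := by
  apply Subset.antisymm
  · intro d hd
    have hd' := mem_interior_iff_mem_nhds.1 hd
    let one : WithLp 2 ((Fin k → ℝ) × ℝ) := WithLp.toLp 2 (fun _ => 1, 1)
    have hc : Continuous (fun ε : ℝ => d + ε • one) := by fun_prop
    have h1 : (fun ε : ℝ => d + ε • one) ⁻¹' DSimp k ∈ nhds (0 : ℝ) := by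
      apply hc.continuousAt.preimage_mem_nhds
      simpa using hd'
    obtain ⟨ε, hε, hb⟩ := Metric.mem_nhds_iff.1 h1
    have hp := @hb (ε / 2) (by rw [mem_ball, Real.dist_eq, abs_lt]; constructor <;> linarith)
    have hm := @hb (-(ε / 2)) (by rw [mem_ball, Real.dist_eq, abs_lt]; constructor <;> linarith)
    obtain ⟨p1, p2, p3⟩ := hp
    obtain ⟨m1, m2, m3⟩ := hm
    simp only [WithLp.add_fst, WithLp.smul_fst, Pi.add_apply, Pi.smul_apply, smul_eq_mul,
      WithLp.add_snd, WithLp.smul_snd, one, WithLp.toLp_fst, WithLp.toLp_snd, mul_one, Finset.sum_add_distrib] at p1 p2 p3 m1 m2 m3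
    refine ⟨fun i => ?_, ?_, ?_⟩
    · linarith [m1 i]
    · linarith
    · have : 0 ≤ ∑ i : Fin k, ε / 2 := Finset.sum_nonneg fun _ _ => by linarith
      linarith
  · apply interior_maximal _ (USimp_open k)
    rintro d ⟨h1, h2, h3⟩
    exact ⟨fun i => (h1 i).le, h2.le, h3.le⟩

theorem USimp_nonempty (k : ℕ) : (USimp k).Nonempty := by
  refine ⟨WithLp.toLp 2 (fun _ => 1 / (k + 2), 1 / (k + 2)), fun i => ?_, ?_, ?_⟩
  · simp; positivity
  · simp; positivity
  · simp
    field_simp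
    linarith

theorem DSimp_bounded (k : ℕ) : Bornology.IsBounded (DSimp k) := by
  rw [isBounded_iff_subset_closedBall 0]
  refine ⟨2, ?_⟩
  rintro d ⟨h1, h2, h3⟩
  rw [mem_closedBall_zero_iff]
  have h := WithLp.prod_norm_sq_eq_of_L2 d
  have hs : 0 ≤ ∑ i, d.fst i := Finset.sum_nonneg fun i _ => h1 i
  have hf : ‖d.fst‖ ≤ 1 := by
    rw [pi_norm_le_iff_of_nonneg zero_le_one]
    intro i
    rw [Real.norm_eq_abs, abs_of_nonneg (h1 i)]
    have := Finset.single_le_sum (fun i _ => h1 i) (Finset.mem_univ i)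
    linarith
  have hsn : ‖d.snd‖ ≤ 1 := by
    rw [Real.norm_eq_abs, abs_of_nonneg h2]; linarith
  rw [← sq_le_sq₀ (norm_nonneg _) (by norm_num), h]
  nlinarith [norm_nonneg d.fst, norm_nonneg d.snd]

theorem phi0_mem (k : ℕ) (u : Fin (k + 2) → ℝ) (hu : u ∈ stdSimplex ℝ (Fin (k + 2))) :
    phi0 k u ∈ DSimp k := by
  obtain ⟨h0, h1⟩ := hu
  refine ⟨fun i => h0 _, h0 _, ?_⟩
  rw [Fin.sum_univ_succ, Fin.sum_univ_succ] at h1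
  have : u (Fin.succ 0) = u 1 := rfl
  rw [this] at h1
  have := h0 0
  simp only [phi0, WithLp.toLp_fst, WithLp.toLp_snd]
  linarith

theorem phi0_mem_fr (k : ℕ) (u : Fin (k + 2) → ℝ) (hu : u ∈ stdSimplex ℝ (Fin (k + 2)))
    (hz : ∃ i, u i = 0) : phi0 k u ∈ frontier (DSimp k) := by
  rw [(DSimp_closed k).frontier_eq, DSimp_interior]
  refine ⟨phi0_mem k u hu, ?_⟩
  rintro ⟨h1, h2, h3⟩
  obtain ⟨h0, hs⟩ := hu
  rw [Fin.sum_univ_succ, Fin.sum_univ_succ] at hs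
  have : u (Fin.succ 0) = u 1 := rfl
  rw [this] at hs
  simp only [phi0, WithLp.toLp_fst, WithLp.toLp_snd] at h1 h2 h3
  obtain ⟨i, hi⟩ := hz
  revert hi
  refine Fin.cases ?_ (fun j => ?_) i
  · intro hi; linarith
  · refine Fin.cases ?_ (fun j => ?_) j
    · intro hi; exact h2.ne' hi
    · intro hi; exact (h1 j).ne' hi

theorem psi0_mem (k : ℕ) (d) (hd : d ∈ DSimp k) : psi0 k d ∈ stdSimplex ℝ (Fin (k + 2)) := by
  obtain ⟨h1, h2, h3⟩ := hd
  constructor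
  · intro j
    refine Fin.cases ?_ (fun j => ?_) j
    · simp only [psi0, Fin.cons_zero]; linarith
    · simp only [psi0, Fin.cons_succ]
      refine Fin.cases ?_ (fun j => ?_) j
      · simpa using h2
      · simpa using h1 j
  · rw [Fin.sum_univ_succ, Fin.sum_univ_succ]
    simp only [psi0, Fin.cons_succ, Fin.cons_zero]
    ring

theorem psi0_mem_bd (k : ℕ) (d) (hd : d ∈ frontier (DSimp k)) : ∃ i, psi0 k d i = 0 := by
  rw [(DSimp_closed k).frontier_eq, DSimp_interior] at hd
  obtain ⟨⟨h1, h2, h3⟩, hn⟩ := hd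
  by_contra hc
  push Not at hc
  apply hn
  refine ⟨fun i => lt_of_le_of_ne (h1 i) ?_, lt_of_le_of_ne h2 ?_, lt_of_le_of_ne h3 ?_⟩
  · have := hc i.succ.succ
    simp only [psi0, Fin.cons_succ] at this
    exact this.symm
  · have := hc (Fin.succ 0)
    simp only [psi0, Fin.cons_succ, Fin.cons_zero] at this
    exact this.symm
  · have := hc 0
    simp only [psi0, Fin.cons_zero] at this
    intro h; apply this; linarith

theorem fin_ext {X : Type*} [TopologicalSpace X] [Nonempty X] (n : ℕ)
    (hX : VanishingHomotopyBelow n X) (m : ℕ) (hm : m ≤ n) (f : (Fin (m + 1) → ℝ) → X)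
    (hf : ContinuousOn f {u | u ∈ stdSimplex ℝ (Fin (m + 1)) ∧ ∃ i, u i = 0}) :
    ∃ F : (Fin (m + 1) → ℝ) → X, ContinuousOn F (stdSimplex ℝ (Fin (m + 1))) ∧
      EqOn F f {u | u ∈ stdSimplex ℝ (Fin (m + 1)) ∧ ∃ i, u i = 0} := by
  match m with
  | 0 =>
    refine ⟨fun _ => Classical.arbitrary X, continuousOn_const, ?_⟩
    rintro u ⟨⟨h0, h1⟩, i, hi⟩
    exfalso
    rw [Fin.sum_univ_one] at h1
    rw [show i = 0 from Fin.ext (by omega)] at hi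
    linarith
  | 1 =>
    have hj : ∀ a b : X, Joined a b := by
      intro a b
      have := hX 0 hm a
      have h2 : Subsingleton (ZerothHomotopy X) :=
        (HomotopyGroup.pi0EquivZerothHomotopy (X := X) (x := a)).symm.subsingleton
      exact Quotient.exact (Subsingleton.elim (α := ZerothHomotopy X) ⟦a⟧ ⟦b⟧)
    let γ := (hj (f ![1, 0]) (f ![0, 1])).somePath
    refine ⟨fun u => γ.extend (u 1), ?_, ?_⟩
    · exact (γ.continuous_extend.comp (continuous_apply 1)).continuousOn
    · rintro u ⟨⟨h0, h1⟩, i, hi⟩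
      rw [Fin.sum_univ_two] at h1
      revert hi
      refine Fin.cases ?_ (fun j => ?_) i
      · intro hi
        have hu : u = ![0, 1] := by
          ext j; fin_cases j
          · simpa using hi
          · simp; linarith
        rw [hu]
        simp
      · intro hi
        have hi : u 1 = 0 := by
          rw [← hi]; congr 1; fin_cases j; rfl
        have hu : u = ![1, 0] := by
          ext j; fin_cases j
          · simp; linarith
          · simpa using hi
        rw [hu]
        simp
  | k + 2 =>
    obtain ⟨h, -, hcl, hfr⟩ := exists_homeomorph_image_interior_closure_frontier_eq_unitBall
      (DSimp_convex (k + 1)) (by rw [DSimp_interior]; exact USimp_nonempty _) (DSimp_bounded (k + 1))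
    rw [(DSimp_closed _).closure_eq] at hcl
    obtain ⟨G, hG, hGf⟩ := sphere_ext (k + 1) (by omega) (hX (k + 1) (by omega))
      (fun d => f (psi0 (k + 1) (h.symm d))) (by
        refine hf.comp ((psi0_cont _).comp h.symm.continuous).continuousOn ?_
        intro d hd
        rw [← hfr] at hd
        obtain ⟨d, hd, rfl⟩ := hd
        simp only [h.symm_apply_apply]
        exact ⟨psi0_mem _ _ ((DSimp_closed _).frontier_subset hd), psi0_mem_bd _ _ hd⟩)
    refine ⟨fun u => G (h (phi0 _ u)), ?_, ?_⟩
    · refine hG.comp (h.continuous.comp (phi0_cont _)).continuousOn ?_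
      intro u hu
      rw [← hcl]
      exact mem_image_of_mem _ (phi0_mem _ u hu)
    · rintro u ⟨hu, hz⟩
      have : h (phi0 _ u) ∈ sphere (0 : WithLp 2 ((Fin (k + 1) → ℝ) × ℝ)) 1 := by
        rw [← hfr]
        exact mem_image_of_mem _ (phi0_mem_fr _ u hu hz)
      have h2 := hGf this
      simp only at h2 ⊢
      rw [h2, h.symm_apply_apply, psi0_phi0 _ _ hu.2]

/-- closed cell of the full simplex on `ι` spanned by `S`. -/
def cellS {ι : Type*} (S : Finset ι) : Set (ι → ℝ) :=
  {t | (∀ i, 0 ≤ t i) ∧ (∀ i, i ∉ S → t i = 0) ∧ ∑ i ∈ S, t i = 1}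

def bdS {ι : Type*} (S : Finset ι) : Set (ι → ℝ) :=
  {t | t ∈ cellS S ∧ ∃ i ∈ S, t i = 0}

theorem cell_ext {ι X : Type*} [TopologicalSpace X] [Nonempty X] (n : ℕ)
    (hX : VanishingHomotopyBelow n X) (S : Finset ι) (hS : S.Nonempty) (hm : S.card ≤ n + 1)
    (f : (ι → ℝ) → X) (hf : ContinuousOn f (bdS S)) :
    ∃ F : (ι → ℝ) → X, ContinuousOn F (cellS S) ∧ EqOn F f (bdS S) := by
  obtain ⟨m, hm'⟩ : ∃ m, S.card = m + 1 := ⟨S.card - 1, by have := hS.card_pos; omega⟩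
  let e : S ≃ Fin (m + 1) := S.equivFinOfCardEq hm'
  let ψ : (Fin (m + 1) → ℝ) → (ι → ℝ) := fun u j => if h : j ∈ S then u (e ⟨j, h⟩) else 0
  let φ : (ι → ℝ) → (Fin (m + 1) → ℝ) := fun t i => t (e.symm i)
  have hψ : Continuous ψ := by
    refine continuous_pi fun j => ?_
    by_cases h : j ∈ S
    · simp only [ψ, dif_pos h]; fun_prop
    · simp only [ψ, dif_neg h]; fun_prop
  have hφ : Continuous φ := by fun_prop
  have hsum : ∀ t : ι → ℝ, ∑ i, φ t i = ∑ i ∈ S, t i := by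
    intro t
    rw [← Finset.sum_coe_sort S t]
    exact Equiv.sum_comp e.symm (fun j : S => t j)
  have hφψ : ∀ u, φ (ψ u) = u := by
    intro u; funext i; simp [φ, ψ]
  have hψφ : ∀ t ∈ cellS S, ψ (φ t) = t := by
    intro t ht; funext j
    by_cases h : j ∈ S
    · simp [ψ, φ, h]
    · simp [ψ, h, ht.2.1 j h]
  have hφm : ∀ t ∈ cellS S, φ t ∈ stdSimplex ℝ (Fin (m + 1)) := by
    intro t ht
    exact ⟨fun i => ht.1 _, by rw [hsum]; exact ht.2.2⟩
  have hψm : ∀ u ∈ stdSimplex ℝ (Fin (m + 1)), ψ u ∈ cellS S := by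
    intro u hu
    refine ⟨fun j => ?_, fun j hj => by simp [ψ, hj], ?_⟩
    · by_cases h : j ∈ S
      · simp only [ψ, dif_pos h]; exact hu.1 _
      · simp only [ψ, dif_neg h]; exact le_rfl
    · rw [← hsum, hφψ]; exact hu.2
  obtain ⟨G, hG, hGf⟩ := fin_ext n hX m (by omega) (fun u => f (ψ u)) (by
    refine hf.comp hψ.continuousOn ?_
    rintro u ⟨hu, i, hi⟩
    exact ⟨hψm u hu, e.symm i, (e.symm i).2, by simp [ψ, hi]⟩)
  refine ⟨fun t => G (φ t), hG.comp hφ.continuousOn hφm, ?_⟩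
  rintro t ⟨ht, i, hiS, hi⟩
  have h2 := hGf (x := φ t) ⟨hφm t ht, e ⟨i, hiS⟩, by simp [φ, hi]⟩
  simp only at h2 ⊢
  rw [h2, hψφ t ht]

end simplex


section carrier

theorem cellS_closed {ι : Type*} (S : Finset ι) : IsClosed (cellS S) := by
  have : cellS S = (⋂ i, {t : ι → ℝ | 0 ≤ t i}) ∩ ((⋂ i, {t | i ∉ S → t i = 0}) ∩
      {t | ∑ i ∈ S, t i = 1}) := by
    ext t; simp [cellS]
  rw [this]
  refine (isClosed_iInter fun i => ?_).inter ((isClosed_iInter fun i => ?_).inter ?_)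
  · exact isClosed_le continuous_const (by fun_prop)
  · by_cases h : i ∈ S
    · simp [h]
    · simp only [h, not_false_eq_true, forall_const]
      exact isClosed_eq (by fun_prop) continuous_const
  · exact isClosed_eq (by fun_prop) continuous_const

theorem bdS_eq {ι : Type*} (S : Finset ι) : bdS S = ⋃ i : S, cellS (S.erase i) := by
  ext t
  simp only [mem_iUnion]
  constructor
  · rintro ⟨⟨h0, h1, h2⟩, i, hi, hti⟩
    refine ⟨⟨i, hi⟩, h0, fun j hj => ?_, ?_⟩
    · by_cases hji : j = i
      · rw [hji, hti]
      · exact h1 j fun hjS => hj (Finset.mem_erase.2 ⟨hji, hjS⟩)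
    · rw [← h2, ← Finset.add_sum_erase S t hi, hti, zero_add]
  · rintro ⟨⟨i, hi⟩, h0, h1, h2⟩
    have hti : t i = 0 := h1 i (by simp)
    refine ⟨⟨h0, fun j hj => h1 j fun hjS => hj (Finset.mem_of_mem_erase hjS), ?_⟩, i, hi, hti⟩
    rw [← h2, ← Finset.add_sum_erase S t hi, hti, zero_add]

theorem cellS_nonempty_of_mem {ι : Type*} {S : Finset ι} {t : ι → ℝ} (h : t ∈ cellS S) :
    S.Nonempty := by
  by_contra hc
  rw [Finset.not_nonempty_iff_eq_empty] at hc
  subst hc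
  have := h.2.2
  simp at this

theorem carrier_ext {ι Z : Type*} [TopologicalSpace Z] (n : ℕ) (N N1 : Set (Finset ι))
    (hdown : ∀ S ∈ N, ∀ T ⊆ S, T.Nonempty → T ∈ N)
    (hdown1 : ∀ S ∈ N1, ∀ T ⊆ S, T.Nonempty → T ∈ N1)
    (hne : ∀ S ∈ N, S.Nonempty)
    (hcard : ∀ S ∈ N, S.card ≤ n + 1)
    (C : Finset ι → Set Z) (hmono : ∀ S ∈ N, ∀ T ∈ N, T ⊆ S → C T ⊆ C S)
    (h1 : (ι → ℝ) → Z) (hc1 : ∀ S ∈ N1, ContinuousOn h1 (cellS S))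
    (hm1 : ∀ S ∈ N1, MapsTo h1 (cellS S) (C S))
    (hvan : ∀ S ∈ N, S ∉ N1 → VanishingHomotopyBelow n (C S) ∧ (C S).Nonempty) :
    ∃ h : (ι → ℝ) → Z, (∀ S ∈ N1, EqOn h h1 (cellS S)) ∧
      ∀ S ∈ N, ContinuousOn h (cellS S) ∧ MapsTo h (cellS S) (C S) := by
  suffices H : ∀ m : ℕ, ∃ h : (ι → ℝ) → Z, (∀ S ∈ N1, EqOn h h1 (cellS S)) ∧
      ∀ S ∈ N, S.card ≤ m → ContinuousOn h (cellS S) ∧ MapsTo h (cellS S) (C S) by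
    obtain ⟨h, ha, hb⟩ := H (n + 1)
    exact ⟨h, ha, fun S hS => hb S hS (hcard S hS)⟩
  intro m
  induction m with
  | zero =>
    refine ⟨h1, fun S _ => eqOn_refl _ _, fun S hS hS0 => ?_⟩
    have := (hne S hS).card_pos
    omega
  | succ m ih =>
    obtain ⟨h, ha, hb⟩ := ih
    have key : ∀ S : Finset ι, S ∈ N → S ∉ N1 → S.card = m + 1 →
        ∃ G : (ι → ℝ) → Z, ContinuousOn G (cellS S) ∧ MapsTo G (cellS S) (C S) ∧
          EqOn G h (bdS S) := by
      intro S hS hS1 hSc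
      have her : ∀ i : S, ContinuousOn h (cellS (S.erase i)) ∧ MapsTo h (cellS (S.erase i)) (C S) := by
        intro i
        by_cases hE : (S.erase i).Nonempty
        · have hEN := hdown S hS (S.erase i) (Finset.erase_subset _ _) hE
          obtain ⟨p1, p2⟩ := hb _ hEN (by rw [Finset.card_erase_of_mem i.2]; omega)
          exact ⟨p1, fun t ht => hmono S hS _ hEN (Finset.erase_subset _ _) (p2 ht)⟩
        · have : cellS (S.erase (i : ι)) = ∅ := by
            ext t; simp only [mem_empty_iff_false, iff_false]
            exact fun ht => hE (cellS_nonempty_of_mem ht)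
          rw [this]
          exact ⟨continuousOn_empty _, mapsTo_empty _ _⟩
      have hcont : ContinuousOn h (bdS S) := by
        rw [bdS_eq]
        exact (locallyFinite_of_finite _).continuousOn_iUnion (fun i => cellS_closed _)
          (fun i => (her i).1)
      have hmaps : MapsTo h (bdS S) (C S) := by
        rw [bdS_eq]
        exact mapsTo_iUnion.2 fun i => (her i).2
      obtain ⟨hv, ⟨c0, hc0⟩⟩ := hvan S hS hS1
      have : Nonempty (C S) := ⟨⟨c0, hc0⟩⟩
      obtain ⟨F, hF, hFe⟩ := cell_ext n hv S (hne S hS) (hcard S hS)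
        (fun t => if hx : h t ∈ C S then ⟨h t, hx⟩ else ⟨c0, hc0⟩) (by
          rw [Topology.IsInducing.subtypeVal.continuousOn_iff]
          refine hcont.congr fun t ht => ?_
          simp [hmaps ht])
      refine ⟨fun t => (F t : Z), continuous_subtype_val.comp_continuousOn hF,
        fun t _ => (F t).2, fun t ht => ?_⟩
      simp [hFe ht, hmaps ht]
    have key' : ∀ S : Finset ι, ∃ G : (ι → ℝ) → Z, S ∈ N → S ∉ N1 → S.card = m + 1 →
        ContinuousOn G (cellS S) ∧ MapsTo G (cellS S) (C S) ∧ EqOn G h (bdS S) := by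
      intro S
      by_cases hyp : S ∈ N ∧ S ∉ N1 ∧ S.card = m + 1
      · obtain ⟨G, hG⟩ := key S hyp.1 hyp.2.1 hyp.2.2
        exact ⟨G, fun _ _ _ => hG⟩
      · exact ⟨h, fun q1 q2 q3 => absurd ⟨q1, q2, q3⟩ hyp⟩
    choose G hG using key'
    have hG1 := fun S q1 q2 q3 => (hG S q1 q2 q3).1
    have hG2 := fun S q1 q2 q3 => (hG S q1 q2 q3).2.1
    have hG3 := fun S q1 q2 q3 => (hG S q1 q2 q3).2.2
    let P : (ι → ℝ) → Finset ι → Prop := fun t S => S ∈ N ∧ S ∉ N1 ∧ S.card = m + 1 ∧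
      t ∈ cellS S ∧ ∀ i ∈ S, t i ≠ 0
    have hPsub : ∀ t S T, P t S → t ∈ cellS T → S ⊆ T := by
      intro t S T hS hT i hi
      by_contra hiT
      exact hS.2.2.2.2 i hi (hT.2.1 i hiT)
    let h' : (ι → ℝ) → Z := fun t => if hx : ∃ S, P t S then G hx.choose t else h t
    have hold : ∀ t, (¬ ∃ S, P t S) → h' t = h t := fun t ht => by simp only [h', dif_neg ht]
    have hnew : ∀ t S, P t S → h' t = G S t := by
      intro t S hS
      have hx : ∃ S, P t S := ⟨S, hS⟩
      have : hx.choose = S := Finset.Subset.antisymm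
        (hPsub t _ _ hx.choose_spec hS.2.2.2.1) (hPsub t _ _ hS hx.choose_spec.2.2.2.1)
      simp only [h', dif_pos hx, this]
    refine ⟨h', ?_, ?_⟩
    · intro S hS t ht
      rw [hold t, ha S hS ht]
      rintro ⟨T, hT⟩
      exact hT.2.1 (hdown1 S hS T (hPsub t T S hT ht) (hne T hT.1))
    · intro S hS hSc
      by_cases hcase : S ∉ N1 ∧ S.card = m + 1
      · have heq : EqOn h' (G S) (cellS S) := by
          intro t ht
          by_cases hi : ∀ i ∈ S, t i ≠ 0
          · exact hnew t S ⟨hS, hcase.1, hcase.2, ht, hi⟩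
          · push Not at hi
            rw [hold t, hG3 S hS hcase.1 hcase.2 ⟨ht, hi⟩]
            rintro ⟨T, hT⟩
            have := Finset.eq_of_subset_of_card_le (hPsub t T S hT ht) (by rw [hT.2.2.1, hcase.2])
            subst this
            obtain ⟨i, hi1, hi2⟩ := hi
            exact hT.2.2.2.2 i hi1 hi2
        exact ⟨(hG1 S hS hcase.1 hcase.2).congr heq,
          (hG2 S hS hcase.1 hcase.2).congr heq.symm⟩
      · by_cases hS1 : S ∈ N1
        · have heq : EqOn h' h1 (cellS S) := by
            intro t ht
            rw [hold t, ha S hS1 ht]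
            rintro ⟨T, hT⟩
            exact hT.2.1 (hdown1 S hS1 T (hPsub t T S hT ht) (hne T hT.1))
          exact ⟨(hc1 S hS1).congr heq, (hm1 S hS1).congr heq.symm⟩
        · have hSm : S.card ≤ m := by
            by_contra hc
            exact hcase ⟨hS1, by omega⟩
          have heq : EqOn h' h (cellS S) := by
            intro t ht
            rw [hold t]
            rintro ⟨T, hT⟩
            have := Finset.card_le_card (hPsub t T S hT ht)
            rw [hT.2.2.1] at this
            omega
          obtain ⟨p1, p2⟩ := hb S hS hSm
          exact ⟨p1.congr heq, p2.congr heq.symm⟩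

theorem pou_mem_cell {ι Y : Type*} [TopologicalSpace Y] (ρ : PartitionOfUnity ι Y univ) (y : Y)
    (S : Finset ι) (hS : ∀ i, ρ i y ≠ 0 → i ∈ S) : (fun i => ρ i y) ∈ cellS S := by
  refine ⟨fun i => ρ.nonneg i y, fun i hi => ?_, ?_⟩
  · by_contra h; exact hi (hS i h)
  · rw [← ρ.sum_eq_one (mem_univ y)]
    exact (finsum_eq_sum_of_support_subset _ (fun i hi => hS i hi)).symm

theorem pou_comp_cont {ι Y Z : Type*} [TopologicalSpace Y] [TopologicalSpace Z]
    (ρ : PartitionOfUnity ι Y univ) (h : (ι → ℝ) → Z)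
    (hh : ∀ (y : Y) (S : Finset ι), (∀ i, i ∈ S ↔ ρ i y ≠ 0) → ContinuousOn h (cellS S)) :
    Continuous (fun y => h (fun i => ρ i y)) := by
  let D : Finset ι → Set Y := fun S => {y | ∀ i, i ∈ S ↔ ρ i y ≠ 0}
  have hD : LocallyFinite D := by
    intro y
    obtain ⟨W, hW, hfin⟩ := ρ.locallyFinite y
    refine ⟨W, hW, (hfin.toFinset.powerset.finite_toSet).subset ?_⟩
    rintro S ⟨z, hz, hzW⟩
    rw [Finset.mem_coe, Finset.mem_powerset]
    intro i hi
    rw [Set.Finite.mem_toFinset]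
    exact ⟨z, (hz i).1 hi, hzW⟩
  have hρ : Continuous (fun y i => ρ i y) := continuous_pi fun i => (ρ i).continuous
  refine hD.closure.continuous ?_ (fun S => isClosed_closure) (fun S => ?_)
  · rw [eq_univ_iff_forall]
    intro y
    have hf : {i | ρ i y ≠ 0}.Finite := ρ.locallyFinite.point_finite y
    refine mem_iUnion.2 ⟨hf.toFinset, subset_closure ?_⟩
    intro i; simp
  · by_cases hne : (D S).Nonempty
    · obtain ⟨y, hy⟩ := hne
      refine (hh y S hy).comp hρ.continuousOn ?_
      intro z hz
      have : closure (D S) ⊆ (fun y i => ρ i y) ⁻¹' cellS S := by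
        refine closure_minimal ?_ ((cellS_closed S).preimage hρ)
        intro z hz
        exact pou_mem_cell ρ z S fun i hi => (hz i).2 hi
      exact this hz
    · rw [not_nonempty_iff_eq_empty] at hne
      rw [hne, closure_empty]
      exact continuousOn_empty _

end carrier


section nbhd

theorem dugundji_ext {Y E : Type*} [MetricSpace Y] [NormedAddCommGroup E] [NormedSpace ℝ E]
    {B : Set Y} (hB : IsClosed B) (hne : B.Nonempty) (f : Y → E) (hf : ContinuousOn f B) :
    ∃ g : Y → E, Continuous g ∧ EqOn g f B ∧ ∀ y, g y ∈ convexHull ℝ (f '' B) := by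
  have hpos : ∀ y : (Bᶜ : Set Y), 0 < infDist (y : Y) B := fun y =>
    (hB.notMem_iff_infDist_pos hne).1 y.2
  obtain ⟨g1, hg1⟩ := exists_continuous_forall_mem_convex_of_local_const (X := (Bᶜ : Set Y))
    (t := fun y => convexHull ℝ (f '' (B ∩ ball (y : Y) (3 * infDist (y : Y) B))))
    (fun y => convex_convexHull ℝ _) (by
      intro x
      have hx := hpos x
      obtain ⟨a, ha, hxa⟩ := (infDist_lt_iff (r := 2 * infDist (x : Y) B) hne).1 (by linarith)
      refine ⟨f a, ?_⟩
      have h1 : Continuous fun y : (Bᶜ : Set Y) => dist (y : Y) a := by fun_prop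
      have h2 : Continuous fun y : (Bᶜ : Set Y) => 3 * infDist (y : Y) B :=
        continuous_const.mul ((continuous_infDist_pt B).comp continuous_subtype_val)
      have := (isOpen_lt h1 h2).mem_nhds (show dist (x : Y) a < 3 * infDist (x : Y) B by linarith)
      filter_upwards [this] with y hy
      refine subset_convexHull ℝ _ ⟨a, ⟨ha, ?_⟩, rfl⟩
      rw [mem_ball, dist_comm]; exact hy)
  let g : Y → E := fun y => if hy : y ∈ B then f y else g1 ⟨y, hy⟩
  have hgB : ∀ y ∈ B, g y = f y := fun y hy => by simp [g, hy]
  have hgC : ∀ y (hy : y ∉ B), g y = g1 ⟨y, hy⟩ := fun y hy => by simp [g, hy]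
  refine ⟨g, ?_, hgB, ?_⟩
  · rw [continuous_iff_continuousAt]
    intro b
    by_cases hb : b ∈ B
    · rw [Metric.continuousAt_iff]
      intro ε hε
      obtain ⟨δ, hδ, hd⟩ := Metric.continuousWithinAt_iff.1 (hf b hb) ε hε
      refine ⟨δ / 4, by linarith, fun y hy => ?_⟩
      rw [hgB b hb]
      by_cases hyB : y ∈ B
      · rw [hgB y hyB]
        exact hd hyB (by linarith)
      · rw [hgC y hyB]
        have : convexHull ℝ (f '' (B ∩ ball y (3 * infDist y B))) ⊆ ball (f b) ε := by
          refine convexHull_min ?_ (convex_ball _ _)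
          rintro _ ⟨a, ⟨ha, hay⟩, rfl⟩
          refine hd ha ?_
          have h1 := dist_triangle a y b
          have h2 : infDist y B ≤ dist y b := infDist_le_dist_of_mem hb
          rw [mem_ball] at hay
          linarith
        exact this (hg1 ⟨y, hyB⟩)
    · have : ContinuousOn g Bᶜ := by
        rw [continuousOn_iff_continuous_domRestrict]
        refine g1.continuous.congr fun y => ?_
        rw [domRestrict_apply, hgC y y.2]
      exact this.continuousAt (hB.isOpen_compl.mem_nhds hb)
  · intro y
    by_cases hyB : y ∈ B
    · rw [hgB y hyB]
      exact subset_convexHull ℝ _ (mem_image_of_mem _ hyB)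
    · rw [hgC y hyB]
      exact convexHull_mono (image_mono inter_subset_left) (hg1 ⟨y, hyB⟩)

theorem l1_hasSum {V : Type*} (x : lp (fun _ : V => ℝ) 1) : HasSum (fun v => |x v|) ‖x‖ := by
  have := lp.hasSum_norm (p := 1) (by simp) x
  simpa using this

theorem l1_abs_le {V : Type*} (x : lp (fun _ : V => ℝ) 1) (v : V) : |x v| ≤ ‖x‖ := by
  have := lp.norm_apply_le_norm (p := 1) (by simp) x v
  simpa using this

theorem l1_eval_cont {V : Type*} (v : V) : Continuous (fun x : lp (fun _ : V => ℝ) 1 => x v) :=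
  (lp.evalCLM ℝ (fun _ : V => ℝ) 1 v).continuous

noncomputable def mkL1 {V : Type*} (x : lp (fun _ : V => ℝ) 1) (g : V → ℝ)
    (h : ∀ v, |g v| ≤ |x v|) : lp (fun _ : V => ℝ) 1 :=
  ⟨g, memℓp_gen (by
    simpa using (Summable.of_nonneg_of_le (fun v => abs_nonneg _) h (l1_hasSum x).summable))⟩

theorem mkL1_apply {V : Type*} (x : lp (fun _ : V => ℝ) 1) (g : V → ℝ)
    (h : ∀ v, |g v| ≤ |x v|) (v : V) : mkL1 x g h v = g v := rfl

noncomputable def thTerm {V : Type*} (K : SComplex V) (x : lp (fun _ : V => ℝ) 1) (s : Finset V) : ℝ :=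
  if h : s.Nonempty ∧ s ∉ K.faces then s.inf' h.1 (fun v => |x v|) else 0

noncomputable def thK {V : Type*} (K : SComplex V) (x : lp (fun _ : V => ℝ) 1) : ℝ :=
  ⨆ s : Finset V, thTerm K x s

theorem thTerm_nonneg {V : Type*} (K : SComplex V) (x : lp (fun _ : V => ℝ) 1) (s : Finset V) :
    0 ≤ thTerm K x s := by
  unfold thTerm
  split_ifs with h
  · rw [Finset.le_inf'_iff]; intro v _; positivity
  · rfl

theorem thTerm_le {V : Type*} (K : SComplex V) (x : lp (fun _ : V => ℝ) 1) (s : Finset V) :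
    thTerm K x s ≤ ‖x‖ := by
  unfold thTerm
  split_ifs with h
  · obtain ⟨v, hv⟩ := h.1
    exact (Finset.inf'_le _ hv).trans (l1_abs_le x v)
  · positivity

theorem thK_bdd {V : Type*} (K : SComplex V) (x : lp (fun _ : V => ℝ) 1) :
    BddAbove (range (thTerm K x)) := ⟨‖x‖, by rintro _ ⟨s, rfl⟩; exact thTerm_le K x s⟩

theorem thTerm_lip {V : Type*} (K : SComplex V) (x y : lp (fun _ : V => ℝ) 1) (s : Finset V) :
    thTerm K x s ≤ thTerm K y s + ‖x - y‖ := by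
  unfold thTerm
  split_ifs with h
  · rw [← sub_le_iff_le_add, Finset.le_inf'_iff]
    intro v hv
    have h1 := Finset.inf'_le (fun v => |x v|) hv
    have h2 := l1_abs_le (x - y) v
    have h3 : (x - y) v = x v - y v := rfl
    rw [h3] at h2
    have h4 := abs_sub_abs_le_abs_sub (x v) (y v)
    have : s.inf' h.1 (fun v => |x v|) ≤ |x v| := h1
    linarith
  · simp

theorem thK_lip {V : Type*} (K : SComplex V) (x y : lp (fun _ : V => ℝ) 1) :
    thK K x ≤ thK K y + ‖x - y‖ :=
  ciSup_le fun s => (thTerm_lip K x y s).trans (by gcongr; exact le_ciSup (thK_bdd K y) s)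

theorem thK_cont {V : Type*} (K : SComplex V) : Continuous (thK K) := by
  refine (LipschitzWith.of_le_add fun x y => ?_).continuous
  rw [dist_eq_norm]; exact thK_lip K x y

theorem thK_nonneg {V : Type*} (K : SComplex V) (x : lp (fun _ : V => ℝ) 1) : 0 ≤ thK K x :=
  (thTerm_nonneg K x ∅).trans (le_ciSup (thK_bdd K x) ∅)

theorem abs_trunc_le (a t : ℝ) (ht : 0 ≤ t) : |max (|a| - t) 0| ≤ |a| := by
  rw [abs_of_nonneg (le_max_right _ _)]
  exact max_le (by linarith) (abs_nonneg _)

noncomputable def truncK {V : Type*} (K : SComplex V) (x : lp (fun _ : V => ℝ) 1) : lp (fun _ : V => ℝ) 1 :=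
  mkL1 x (fun v => max (|x v| - thK K x) 0) (fun v => abs_trunc_le _ _ (thK_nonneg K x))

theorem truncK_apply {V : Type*} (K : SComplex V) (x : lp (fun _ : V => ℝ) 1) (v : V) :
    truncK K x v = max (|x v| - thK K x) 0 := rfl

theorem truncK_cont {V : Type*} (K : SComplex V) : Continuous (truncK K) := by
  rw [continuous_iff_continuousAt]
  intro x0
  rw [ContinuousAt, tendsto_iff_norm_sub_tendsto_zero]
  let r : lp (fun _ : V => ℝ) 1 → V → ℝ := fun y v =>
    max (|truncK K y v - truncK K x0 v| - |y v - x0 v|) 0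
  have hle : ∀ y v, r y v ≤ 2 * |x0 v| := by
    intro y v
    have h1 : |truncK K y v| ≤ |y v| := abs_trunc_le _ _ (thK_nonneg K y)
    have h2 : |truncK K x0 v| ≤ |x0 v| := abs_trunc_le _ _ (thK_nonneg K x0)
    have h3 := abs_sub (truncK K y v) (truncK K x0 v)
    have h4 := abs_sub_abs_le_abs_sub (y v) (x0 v)
    refine max_le ?_ (by positivity)
    linarith
  have hr0 : ∀ y v, 0 ≤ r y v := fun y v => le_max_right _ _
  have hsum : Summable fun v => 2 * |x0 v| := (l1_hasSum x0).summable.mul_left 2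
  have hT : Filter.Tendsto (fun y => ∑' v, r y v) (nhds x0) (nhds (∑' v : V, (0 : ℝ))) := by
    refine tendsto_tsum_of_dominated_convergence hsum (fun v => ?_) (Filter.Eventually.of_forall fun y v => ?_)
    · have hc : Continuous fun y => r y v := by
        have e1 : Continuous fun y => truncK K y v := by
          simp only [truncK_apply]
          exact ((l1_eval_cont v).abs.sub (thK_cont K)).max continuous_const
        have e2 := l1_eval_cont v
        exact ((e1.sub continuous_const).abs.sub (e2.sub continuous_const).abs).max continuous_const
      have := hc.tendsto x0
      simpa [r] using this
    · rw [Real.norm_of_nonneg (hr0 y v)]; exact hle y v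
  rw [tsum_zero] at hT
  have hn : Filter.Tendsto (fun y : lp (fun _ : V => ℝ) 1 => ‖y - x0‖) (nhds x0) (nhds 0) := by
    rw [← tendsto_iff_norm_sub_tendsto_zero]; exact Filter.tendsto_id
  have hadd := hn.add hT
  rw [add_zero] at hadd
  refine squeeze_zero (fun y => norm_nonneg _) (fun y => ?_) hadd
  have s1 := l1_hasSum (truncK K y - truncK K x0)
  have s2 := l1_hasSum (y - x0)
  have s3 : Summable (r y) := Summable.of_nonneg_of_le (hr0 y) (hle y) hsum
  refine hasSum_le (fun v => ?_) s1 (s2.add s3.hasSum)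
  show |truncK K y v - truncK K x0 v| ≤ |y v - x0 v| + r y v
  have := le_max_left (|truncK K y v - truncK K x0 v| - |y v - x0 v|) 0
  simp only [r]
  linarith

theorem space_norm {V : Type*} (K : SComplex V) {κ : ℝ} {x : lp (fun _ : V => ℝ) 1}
    (hx : x ∈ K.space κ) : ‖x‖ = κ := by
  have h1 := l1_hasSum x
  simp only [abs_of_nonneg (hx.1 _)] at h1
  exact h1.unique hx.2.2

theorem truncK_space {V : Type*} (K : SComplex V) {κ : ℝ} {x : lp (fun _ : V => ℝ) 1}
    (hx : x ∈ K.space κ) : truncK K x = x := by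
  have h0 : thK K x ≤ 0 := by
    refine ciSup_le fun s => ?_
    unfold thTerm
    split_ifs with h
    · obtain ⟨s0, hs0, hsup⟩ := hx.2.1
      have : ¬ s ⊆ s0 := fun hss => h.2 (K.down_closed s0 hs0 s hss h.1)
      obtain ⟨v, hv, hv0⟩ := Finset.not_subset.1 this
      have hxv : x v = 0 := by by_contra hc; exact hv0 (hsup v hc)
      refine (Finset.inf'_le _ hv).trans ?_
      simp [hxv]
    · rfl
  have h1 := le_antisymm h0 (thK_nonneg K x)
  ext v
  rw [truncK_apply, h1, sub_zero, max_eq_left (abs_nonneg _), abs_of_nonneg (hx.1 v)]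

theorem truncK_supp {V : Type*} (K : SComplex V) (x : lp (fun _ : V => ℝ) 1)
    (hfin : {v | x v ≠ 0}.Finite) (hne : truncK K x ≠ 0) :
    ∃ s ∈ K.faces, ∀ v, truncK K x v ≠ 0 → v ∈ s := by
  have hsub : {v | truncK K x v ≠ 0} ⊆ {v | x v ≠ 0} := by
    intro v hv hc
    apply hv
    rw [truncK_apply, hc]
    simpa using thK_nonneg K x
  have hf := hfin.subset hsub
  have hnon : hf.toFinset.Nonempty := by
    by_contra hc
    apply hne
    ext v
    by_contra hv
    exact hc ⟨v, by simpa using hv⟩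
  refine ⟨hf.toFinset, ?_, fun v hv => by simpa using hv⟩
  by_contra hK
  have h1 := le_ciSup (thK_bdd K x) hf.toFinset
  have h2 : thTerm K x hf.toFinset = hf.toFinset.inf' hnon (fun v => |x v|) := by
    unfold thTerm; rw [dif_pos ⟨hnon, hK⟩]
  have h3 : thK K x < hf.toFinset.inf' hnon (fun v => |x v|) := by
    rw [Finset.lt_inf'_iff]
    intro v hv
    have hv' : truncK K x v ≠ 0 := by simpa using hv
    by_contra hc
    apply hv'
    rw [truncK_apply]
    exact max_eq_right (by linarith)
  rw [h2] at h1
  exact absurd h3 (not_lt.2 h1)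

theorem nbhd_ext {V Y : Type*} [MetricSpace Y] (K : SComplex V) {κ : ℝ} (hκ : 0 < κ)
    {B : Set Y} (hB : IsClosed B) (f : Y → lp (fun _ : V => ℝ) 1) (hf : ContinuousOn f B)
    (hfK : ∀ b ∈ B, f b ∈ K.space κ) :
    ∃ (O : Set Y) (F : Y → lp (fun _ : V => ℝ) 1), IsOpen O ∧ B ⊆ O ∧ ContinuousOn F O ∧
      (∀ y ∈ O, F y ∈ K.space κ) ∧ EqOn F f B := by
  rcases B.eq_empty_or_nonempty with rfl | hne
  · exact ⟨∅, f, isOpen_empty, subset_rfl, continuousOn_empty _, by simp, by simp⟩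
  obtain ⟨g, hgc, hgB, hgh⟩ := dugundji_ext hB hne f hf
  have hfin : ∀ y, {v | g y v ≠ 0}.Finite := by
    have hconv : Convex ℝ {x : lp (fun _ : V => ℝ) 1 | {v | x v ≠ 0}.Finite} := by
      intro x hx y hy a b _ _ _
      refine (Set.Finite.union hx hy).subset ?_
      intro v hv
      by_contra hc
      simp only [mem_union, mem_ofPred_eq, not_or, not_not] at hc
      apply hv
      show a * x v + b * y v = 0
      rw [hc.1, hc.2]; simp
    intro y
    refine convexHull_min ?_ hconv (hgh y)
    rintro _ ⟨b, hb, rfl⟩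
    obtain ⟨s, _, hs⟩ := (hfK b hb).2.1
    exact s.finite_toSet.subset fun v hv => hs v hv
  have hTc : Continuous fun y => truncK K (g y) := (truncK_cont K).comp hgc
  refine ⟨{y | truncK K (g y) ≠ 0}, fun y => (κ / ‖truncK K (g y)‖) • truncK K (g y),
    isOpen_ne_fun hTc continuous_const, ?_, ?_, ?_, ?_⟩
  · intro b hb
    rw [mem_ofPred_eq, hgB hb, truncK_space K (hfK b hb), ← norm_ne_zero_iff, space_norm K (hfK b hb)]
    exact hκ.ne'
  · refine ContinuousOn.smul (continuousOn_const.div hTc.norm.continuousOn fun y hy => ?_)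
      hTc.continuousOn
    exact norm_ne_zero_iff.2 hy
  · intro y hy
    have hpos : 0 < ‖truncK K (g y)‖ := norm_pos_iff.2 hy
    have hnn : ∀ v, 0 ≤ truncK K (g y) v := fun v => le_max_right _ _
    refine ⟨fun v => mul_nonneg (by positivity) (hnn v), ?_, ?_⟩
    · obtain ⟨s, hs, hsup⟩ := truncK_supp K (g y) (hfin y) hy
      refine ⟨s, hs, fun v hv => hsup v fun hc => hv ?_⟩
      show _ * truncK K (g y) v = 0
      rw [hc, mul_zero]
    · have := (l1_hasSum (truncK K (g y))).mul_left (κ / ‖truncK K (g y)‖)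
      simp only [abs_of_nonneg (hnn _)] at this
      rw [div_mul_cancel₀ _ hpos.ne'] at this
      exact this
  · intro b hb
    show (κ / ‖truncK K (g b)‖) • truncK K (g b) = f b
    rw [hgB hb, truncK_space K (hfK b hb), space_norm K (hfK b hb), div_self hκ.ne', one_smul]

end nbhd


section combi
open SComplex

theorem space_supp {V : Type*} (K : SComplex V) {κ : ℝ} (hκ : 0 < κ) {x : lp (fun _ : V => ℝ) 1}
    (hx : x ∈ K.space κ) : ∃ S ∈ K.faces, (∀ v, v ∈ S ↔ x v ≠ 0) ∧ ∑ v ∈ S, x v = κ := by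
  obtain ⟨h0, ⟨s, hs, hsup⟩, hsum⟩ := hx
  let S := s.filter fun v => x v ≠ 0
  have hS : ∀ v, v ∈ S ↔ x v ≠ 0 := fun v => by
    simp only [S, Finset.mem_filter]
    exact ⟨fun h => h.2, fun h => ⟨hsup v h, h⟩⟩
  have hSs : ∑ v ∈ S, x v = κ := by
    refine (hasSum_sum_of_ne_finset_zero fun v hv => ?_).unique hsum
    by_contra hc
    exact hv ((hS v).2 hc)
  refine ⟨S, K.down_closed s hs S (Finset.filter_subset _ _) ?_, hS, hSs⟩
  by_contra hc
  rw [Finset.not_nonempty_iff_eq_empty] at hc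
  rw [hc] at hSs
  simp at hSs
  exact hκ.ne hSs

theorem p_formula {V W : Type*} {φ : V → Finset W} (x : lp (fun _ : V => ℝ) 1) (S : Finset V)
    (hS : ∀ v, x v ≠ 0 → v ∈ S) (w : W) :
    (∑' v : V, (if w ∈ φ v then x v / ((φ v).card : ℝ) else 0)) =
      ∑ v ∈ S, (if w ∈ φ v then x v / ((φ v).card : ℝ) else 0) := by
  refine tsum_eq_sum fun v hv => ?_
  have : x v = 0 := by by_contra hc; exact hv (hS v hc)
  simp [this]

theorem p_mem_chainCell {V W : Type*} {K : SComplex V} {L : SComplex W} {κ lam : ℝ} (hκ : 0 < κ)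
    (hlam : 0 < lam) {p : K.space κ → L.space lam} {φ : V → Finset W}
    (hφ3 : ∀ (x : K.space κ) (w : W),
      (p x : lp (fun _ : W => ℝ) 1) w = (lam / κ) *
          ∑' v : V, (if w ∈ φ v then (x : lp (fun _ : V => ℝ) 1) v / ((φ v).card : ℝ) else 0))
    (x : K.space κ) (c : Finset (Finset W)) (hc : ∀ v, (x : lp (fun _ : V => ℝ) 1) v ≠ 0 → φ v ∈ c) :
    p x ∈ L.chainCell lam c := by
  obtain ⟨S, hSK, hS, hsum⟩ := space_supp K hκ x.2
  have h0 := x.2.1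
  refine ⟨fun s => (lam / κ) * ∑ v ∈ S, if φ v = s then (x : lp (fun _ : V => ℝ) 1) v else 0,
    fun s => ?_, fun s hs => ?_, ?_, fun w => ?_⟩
  · refine mul_nonneg (by positivity) (Finset.sum_nonneg fun v _ => ?_)
    split_ifs
    · exact h0 v
    · rfl
  · by_contra hsc
    apply hs
    beta_reduce
    rw [Finset.sum_eq_zero, mul_zero]
    intro v hv
    rw [if_neg]
    rintro rfl
    exact hsc (hc v ((hS v).1 hv))
  · rw [← Finset.mul_sum, Finset.sum_comm]
    have : ∑ v ∈ S, ∑ s ∈ c, (if φ v = s then (x : lp (fun _ : V => ℝ) 1) v else 0) = κ := by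
      refine Eq.trans (Finset.sum_congr rfl fun v hv => ?_) hsum
      rw [Finset.sum_ite_eq, if_pos (hc v ((hS v).1 hv))]
    rw [this]
    field_simp
  · rw [hφ3, p_formula _ S (fun v hv => (hS v).2 hv), Finset.mul_sum]
    have : ∀ s ∈ c, (if w ∈ s then (lam / κ * ∑ v ∈ S, if φ v = s then
        (x : lp (fun _ : V => ℝ) 1) v else 0) / (s.card : ℝ) else 0) =
        ∑ v ∈ S, if φ v = s then (lam / κ) * (if w ∈ φ v then
        (x : lp (fun _ : V => ℝ) 1) v / ((φ v).card : ℝ) else 0) else 0 := by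
      intro s _
      by_cases hw : w ∈ s
      · rw [if_pos hw, mul_div_assoc, Finset.sum_div, Finset.mul_sum]
        refine Finset.sum_congr rfl fun v _ => ?_
        by_cases hv : φ v = s
        · subst hv; simp [hw]
        · simp [hv]
      · rw [if_neg hw]
        symm
        refine Finset.sum_eq_zero fun v _ => ?_
        by_cases hv : φ v = s
        · subst hv; simp [hw]
        · simp [hv]
    rw [Finset.sum_congr rfl this, Finset.sum_comm]
    refine Finset.sum_congr rfl fun v hv => ?_
    rw [Finset.sum_ite_eq, if_pos (hc v ((hS v).1 hv))]

theorem chainCell_mono {W : Type*} (L : SComplex W) (lam : ℝ) {c c' : Finset (Finset W)}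
    (h : c ⊆ c') : L.chainCell lam c ⊆ L.chainCell lam c' := by
  rintro y ⟨t, h0, h1, h2, h3⟩
  have hz : ∀ s, s ∉ c → t s = 0 := fun s hs => by by_contra hc; exact hs (h1 s hc)
  refine ⟨t, h0, fun s hs => h (h1 s hs), ?_, fun w => ?_⟩
  · rw [← h2]
    exact (Finset.sum_subset h fun s _ hs => hz s hs).symm
  · rw [h3 w]
    exact Finset.sum_subset h fun s _ hs => by simp [hz s hs]

theorem bst_of_chain {W : Type*} (L : SComplex W) {lam : ℝ} (hlam : 0 < lam)
    {c : Finset (Finset W)} (hc : L.IsChainOfFaces c) {v : W} (hv : ({v} : Finset W) ∈ L.faces)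
    (hvc : ∀ s ∈ c, v ∈ s) : L.chainCell lam c ⊆ L.bstVertex lam v := by
  intro y hy
  let z : lp (fun _ : W => ℝ) 1 := lp.single 1 v lam
  have hz : ∀ w, z w = if w = v then lam else 0 := fun w => by
    simp only [z, lp.single_apply, Pi.single_apply]
  have hzL : z ∈ L.space lam := by
    refine ⟨fun w => ?_, ⟨{v}, hv, fun w hw => ?_⟩, ?_⟩
    · rw [hz]; split_ifs <;> linarith
    · rw [hz] at hw; simp only [Finset.mem_singleton]; by_contra hc; simp [hc] at hw
    · simp only [hz]; exact hasSum_ite_eq v lam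
  unfold bstVertex bst
  simp only [mem_iUnion]
  refine ⟨insert {v} c, ⟨⟨⟨{v}, by simp⟩, ?_, ?_⟩, ⟨z, hzL⟩, ?_, ?_⟩,
    chainCell_mono L lam (Finset.subset_insert _ _) hy⟩
  · intro s hs
    rcases Finset.mem_insert.1 hs with rfl | hs
    · exact hv
    · exact hc.2.1 s hs
  · intro s1 hs1 s2 hs2
    rcases Finset.mem_insert.1 hs1 with rfl | hs1 <;> rcases Finset.mem_insert.1 hs2 with rfl | hs2
    · left; rfl
    · left; simpa using hvc s2 hs2
    · right; simpa using hvc s1 hs1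
    · exact hc.2.2 s1 hs1 s2 hs2
  · refine ⟨fun s => if s = {v} then lam else 0, fun s => ?_, fun s hs => ?_, ?_, fun w => ?_⟩
    · dsimp only; split_ifs <;> linarith
    · by_contra hcc
      apply hs
      beta_reduce
      rw [if_neg]
      rintro rfl
      exact hcc (Finset.mem_insert_self _ _)
    · rw [Finset.sum_ite_eq', if_pos (Finset.mem_insert_self _ _)]
    · show z w = _
      rw [Finset.sum_eq_single ({v} : Finset W)]
      · rw [hz]; simp
      · intro s _ hs; simp [hs]
      · intro h; exact absurd (Finset.mem_insert_self _ _) h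
  · refine ⟨{v}, rfl, fun w hw => ?_⟩
    rw [Finset.mem_singleton]
    by_contra hcc
    exact hw (by show z w = 0; rw [hz]; simp [hcc])

theorem bst_max {W : Type*} (L : SComplex W) {lam : ℝ} (hlam : 0 < lam) {v : W}
    {y : L.space lam} (hy : y ∈ L.bstVertex lam v) (w : W) :
    (y : lp (fun _ : W => ℝ) 1) w ≤ (y : lp (fun _ : W => ℝ) 1) v := by
  unfold bstVertex bst at hy
  simp only [mem_iUnion] at hy
  obtain ⟨c, ⟨hc, z, ⟨t, t0, t1, t2, t3⟩, s0, hs0, hsup⟩, r, r0, r1, r2, r3⟩ := hy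
  obtain rfl : s0 = {v} := hs0
  have hex : ∃ s ∈ c, 0 < t s := by
    by_contra hcon
    push Not at hcon
    have := Finset.sum_nonpos hcon
    linarith
  obtain ⟨s, hs, hts⟩ := hex
  have hsv : ∀ u ∈ s, u = v := by
    intro u hu
    have hpos : 0 < (z : lp (fun _ : W => ℝ) 1) u := by
      rw [t3 u]
      refine Finset.sum_pos' (fun s' _ => ?_) ⟨s, hs, ?_⟩
      · split_ifs
        · exact div_nonneg (t0 s') (by positivity)
        · rfl
      · rw [if_pos hu]
        have : 0 < s.card := Finset.card_pos.2 ⟨u, hu⟩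
        positivity
    simpa using hsup u hpos.ne'
  have hvc : ∀ s' ∈ c, v ∈ s' := by
    intro s' hs'
    obtain ⟨u, hu⟩ := L.nonempty_of_mem s (hc.2.1 s hs)
    obtain ⟨u', hu'⟩ := L.nonempty_of_mem s' (hc.2.1 s' hs')
    rcases hc.2.2 s hs s' hs' with h | h
    · rw [← hsv u hu]; exact h hu
    · rw [← hsv u' (h hu')]; exact hu'
  rw [r3 w, r3 v]
  refine Finset.sum_le_sum fun s' hs' => ?_
  rw [if_pos (hvc s' hs')]
  split_ifs
  · rfl
  · exact div_nonneg (r0 s') (by positivity)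

theorem min_face {V W : Type*} {φ : V → Finset W} (S : Finset V) (hS : S.Nonempty)
    (hch : ∀ v₁ ∈ S, ∀ v₂ ∈ S, φ v₁ ⊆ φ v₂ ∨ φ v₂ ⊆ φ v₁) :
    ∃ u ∈ S, ∀ v ∈ S, φ u ⊆ φ v := by
  obtain ⟨u, hu, hmin⟩ := S.exists_min_image (fun v => (φ v).card) hS
  refine ⟨u, hu, fun v hv => ?_⟩
  rcases hch u hu v hv with h | h
  · exact h
  · exact (Finset.eq_of_subset_of_card_le h (hmin v hv)).symm.subset

theorem mem_of_bst {V W : Type*} {K : SComplex V} {L : SComplex W} {κ lam : ℝ} (hκ : 0 < κ)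
    (hlam : 0 < lam) {p : K.space κ → L.space lam} {φ : V → Finset W}
    (hφ1 : ∀ v : V, ({v} : Finset V) ∈ K.faces → φ v ∈ L.faces)
    (hφ2 : ∀ s ∈ K.faces, ∀ v₁ ∈ s, ∀ v₂ ∈ s, φ v₁ ⊆ φ v₂ ∨ φ v₂ ⊆ φ v₁)
    (hφ3 : ∀ (x : K.space κ) (w : W),
      (p x : lp (fun _ : W => ℝ) 1) w = (lam / κ) *
          ∑' v : V, (if w ∈ φ v then (x : lp (fun _ : V => ℝ) 1) v / ((φ v).card : ℝ) else 0))
    (x : K.space κ) {v : W} (hx : p x ∈ L.bstVertex lam v) (u : V)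
    (hu : (x : lp (fun _ : V => ℝ) 1) u ≠ 0) : v ∈ φ u := by
  obtain ⟨S, hSK, hS, hsum⟩ := space_supp K hκ x.2
  have h0 := x.2.1
  have hL : ∀ v ∈ S, φ v ∈ L.faces := fun v hv =>
    hφ1 v (K.down_closed S hSK {v} (by simpa using hv) (by simp))
  obtain ⟨u0, hu0, hmin⟩ := min_face S (K.nonempty_of_mem S hSK) (hφ2 S hSK)
  obtain ⟨w, hw⟩ := L.nonempty_of_mem _ (hL u0 hu0)
  by_contra hvu
  have hle := bst_max L hlam hx w
  rw [hφ3, hφ3, p_formula _ S (fun v hv => (hS v).2 hv),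
    p_formula _ S (fun v hv => (hS v).2 hv)] at hle
  have hpos : 0 < lam / κ := by positivity
  have hle := le_of_mul_le_mul_left hle hpos
  refine absurd hle (not_le.2 ?_)
  have huS := (hS u).2 hu
  refine Finset.sum_lt_sum (fun v' hv' => ?_) ⟨u, huS, ?_⟩
  · rw [if_pos (hmin v' hv' hw)]
    split_ifs
    · rfl
    · exact div_nonneg (h0 v') (by positivity)
  · rw [if_neg hvu, if_pos (hmin u huS hw)]
    have h1 : 0 < (φ u).card := Finset.card_pos.2 ⟨w, hmin u huS hw⟩
    have h2 : 0 < (x : lp (fun _ : V => ℝ) 1) u := lt_of_le_of_ne (h0 u) (Ne.symm hu)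
    positivity

def subK {V W : Type*} (K : SComplex V) (φ : V → Finset W) (A : Finset W) : SComplex V where
  faces := {s | s ∈ K.faces ∧ ∀ v ∈ s, A ⊆ φ v}
  nonempty_of_mem := fun s hs => K.nonempty_of_mem s hs.1
  down_closed := fun s hs t ht hne => ⟨K.down_closed s hs.1 t ht hne, fun v hv => hs.2 v (ht hv)⟩

theorem image_chain {V W : Type*} {K : SComplex V} {L : SComplex W} {φ : V → Finset W}
    (hφ1 : ∀ v : V, ({v} : Finset V) ∈ K.faces → φ v ∈ L.faces)
    (hφ2 : ∀ s ∈ K.faces, ∀ v₁ ∈ s, ∀ v₂ ∈ s, φ v₁ ⊆ φ v₂ ∨ φ v₂ ⊆ φ v₁)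
    {S : Finset V} (hS : S ∈ K.faces) : L.IsChainOfFaces (S.image φ) := by
  refine ⟨(K.nonempty_of_mem S hS).image φ, ?_, ?_⟩
  · intro s hs
    obtain ⟨v, hv, rfl⟩ := Finset.mem_image.1 hs
    exact hφ1 v (K.down_closed S hS {v} (by simpa using hv) (by simp))
  · intro s1 hs1 s2 hs2
    obtain ⟨v1, hv1, rfl⟩ := Finset.mem_image.1 hs1
    obtain ⟨v2, hv2, rfl⟩ := Finset.mem_image.1 hs2
    exact hφ2 S hS v1 hv1 v2 hv2

theorem bst_cover {V W : Type*} {K : SComplex V} {L : SComplex W} {κ lam : ℝ} (hκ : 0 < κ)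
    (hlam : 0 < lam) {p : K.space κ → L.space lam} {φ : V → Finset W}
    (hφ1 : ∀ v : V, ({v} : Finset V) ∈ K.faces → φ v ∈ L.faces)
    (hφ2 : ∀ s ∈ K.faces, ∀ v₁ ∈ s, ∀ v₂ ∈ s, φ v₁ ⊆ φ v₂ ∨ φ v₂ ⊆ φ v₁)
    (hφ3 : ∀ (x : K.space κ) (w : W),
      (p x : lp (fun _ : W => ℝ) 1) w = (lam / κ) *
          ∑' v : V, (if w ∈ φ v then (x : lp (fun _ : V => ℝ) 1) v / ((φ v).card : ℝ) else 0))
    (x : K.space κ) : ∃ w, ({w} : Finset W) ∈ L.faces ∧ p x ∈ L.bstVertex lam w := by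
  obtain ⟨S, hSK, hS, hsum⟩ := space_supp K hκ x.2
  obtain ⟨u0, hu0, hmin⟩ := min_face S (K.nonempty_of_mem S hSK) (hφ2 S hSK)
  have hch := image_chain hφ1 hφ2 hSK (L := L)
  have hf := hch.2.1 (φ u0) (Finset.mem_image_of_mem φ hu0)
  obtain ⟨w, hw⟩ := L.nonempty_of_mem _ hf
  have hwf := L.down_closed _ hf {w} (by simpa using hw) (by simp)
  refine ⟨w, hwf, bst_of_chain L hlam hch hwf ?_ (p_mem_chainCell hκ hlam hφ3 x _ ?_)⟩
  · intro s hs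
    obtain ⟨v, hv, rfl⟩ := Finset.mem_image.1 hs
    exact hmin v hv hw
  · intro v hv
    exact Finset.mem_image_of_mem φ ((hS v).2 hv)

theorem mem_subK {V W : Type*} {K : SComplex V} {κ : ℝ} (hκ : 0 < κ) {φ : V → Finset W}
    {A : Finset W} {x : lp (fun _ : V => ℝ) 1} :
    x ∈ (subK K φ A).space κ ↔ x ∈ K.space κ ∧ ∀ u, x u ≠ 0 → A ⊆ φ u := by
  constructor
  · rintro ⟨h0, ⟨s, hs, hsup⟩, hsum⟩
    exact ⟨⟨h0, ⟨s, hs.1, hsup⟩, hsum⟩, fun u hu => hs.2 u (hsup u hu)⟩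
  · rintro ⟨hx, hA⟩
    obtain ⟨S, hSK, hS, hsum⟩ := space_supp K hκ hx
    exact ⟨hx.1, ⟨S, ⟨hSK, fun v hv => hA v ((hS v).1 hv)⟩, fun v hv => (hS v).2 hv⟩, hx.2.2⟩

theorem bst_inter {V W : Type*} {K : SComplex V} {L : SComplex W} {κ lam : ℝ} (hκ : 0 < κ)
    (hlam : 0 < lam) {p : K.space κ → L.space lam} {φ : V → Finset W}
    (hφ1 : ∀ v : V, ({v} : Finset V) ∈ K.faces → φ v ∈ L.faces)
    (hφ2 : ∀ s ∈ K.faces, ∀ v₁ ∈ s, ∀ v₂ ∈ s, φ v₁ ⊆ φ v₂ ∨ φ v₂ ⊆ φ v₁)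
    (hφ3 : ∀ (x : K.space κ) (w : W),
      (p x : lp (fun _ : W => ℝ) 1) w = (lam / κ) *
          ∑' v : V, (if w ∈ φ v then (x : lp (fun _ : V => ℝ) 1) v / ((φ v).card : ℝ) else 0))
    {A : Finset W} (hA : A ∈ L.faces) (x : K.space κ) :
    (x : lp (fun _ : V => ℝ) 1) ∈ (subK K φ A).space κ ↔ ∀ a ∈ A, p x ∈ L.bstVertex lam a := by
  rw [mem_subK hκ]
  constructor
  · rintro ⟨hx, hu⟩ a ha
    obtain ⟨S, hSK, hS, hsum⟩ := space_supp K hκ x.2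
    have hch := image_chain hφ1 hφ2 hSK (L := L)
    have hwf := L.down_closed _ hA {a} (by simpa using ha) (by simp)
    refine bst_of_chain L hlam hch hwf ?_ (p_mem_chainCell hκ hlam hφ3 x _ ?_)
    · intro s hs
      obtain ⟨v, hv, rfl⟩ := Finset.mem_image.1 hs
      exact hu v ((hS v).1 hv) ha
    · intro v hv
      exact Finset.mem_image_of_mem φ ((hS v).2 hv)
  · intro h
    exact ⟨x.2, fun u hu a ha => mem_of_bst hκ hlam hφ1 hφ2 hφ3 x (h a ha) u hu⟩

end combi


section mainpart
open SComplex

noncomputable def ptL {ι V : Type*} (κ : ℝ) (vv : ι → V) (S : Finset ι) (t : ι → ℝ) :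
    lp (fun _ : V => ℝ) 1 :=
  ∑ i ∈ S, (κ * t i) • (lp.single 1 (vv i) (1 : ℝ) : lp (fun _ : V => ℝ) 1)

theorem ptL_apply {ι V : Type*} (κ : ℝ) (vv : ι → V) (S : Finset ι) (t : ι → ℝ) (w : V) :
    ptL κ vv S t w = ∑ i ∈ S, if w = vv i then κ * t i else 0 := by
  unfold ptL
  rw [lp.coeFn_sum, Finset.sum_apply]
  refine Finset.sum_congr rfl fun i _ => ?_
  show (κ * t i) * (lp.single 1 (vv i) (1 : ℝ) : lp (fun _ : V => ℝ) 1) w = _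
  rw [lp.single_apply, Pi.single_apply]
  split_ifs <;> simp

theorem ptL_cont {ι V : Type*} (κ : ℝ) (vv : ι → V) (S : Finset ι) :
    Continuous (ptL κ vv S) := by
  unfold ptL
  refine continuous_finsetSum _ fun i _ => ?_
  exact (continuous_const.mul (continuous_apply i)).smul continuous_const

theorem ptL_eq {ι V : Type*} (κ : ℝ) (vv : ι → V) {S S' : Finset ι} {t : ι → ℝ}
    (h : t ∈ cellS S) (h' : t ∈ cellS S') : ptL κ vv S t = ptL κ vv S' t := by
  unfold ptL
  rw [Finset.sum_subset (Finset.subset_union_left (s₁ := S) (s₂ := S')) (fun i _ hi => by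
    rw [h.2.1 i hi]; simp), Finset.sum_subset (Finset.subset_union_right (s₁ := S) (s₂ := S'))
    (fun i _ hi => by rw [h'.2.1 i hi]; simp)]

theorem ptL_supp {ι V : Type*} (κ : ℝ) (vv : ι → V) {S : Finset ι} {t : ι → ℝ} {w : V}
    (hw : ptL κ vv S t w ≠ 0) : ∃ i ∈ S, vv i = w := by
  by_contra hc
  push Not at hc
  apply hw
  rw [ptL_apply]
  exact Finset.sum_eq_zero fun i hi => if_neg fun h => hc i hi h.symm

theorem ptL_mem {ι V : Type*} (K : SComplex V) {κ : ℝ} (hκ : 0 < κ) (vv : ι → V) {S : Finset ι}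
    {t : ι → ℝ} (ht : t ∈ cellS S) {s : Finset V} (hs : s ∈ K.faces) (hv : ∀ i ∈ S, vv i ∈ s) :
    ptL κ vv S t ∈ K.space κ := by
  refine ⟨fun w => ?_, ⟨s, hs, fun w hw => ?_⟩, ?_⟩
  · rw [ptL_apply]
    refine Finset.sum_nonneg fun i _ => ?_
    split_ifs
    · exact mul_nonneg hκ.le (ht.1 i)
    · rfl
  · obtain ⟨i, hi, rfl⟩ := ptL_supp κ vv hw
    exact hv i hi
  · simp only [ptL_apply]
    have : κ = ∑ i ∈ S, κ * t i := by rw [← Finset.mul_sum, ht.2.2, mul_one]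
    conv => arg 2; rw [this]
    exact hasSum_sum fun i _ => hasSum_ite_eq (vv i) _

theorem chainCell_nonempty {W : Type*} (L : SComplex W) {lam : ℝ} (hlam : 0 < lam)
    {c : Finset (Finset W)} (hc : L.IsChainOfFaces c) : (L.chainCell lam c).Nonempty := by
  obtain ⟨s, hs⟩ := hc.1
  have hsL := hc.2.1 s hs
  have hcard : 0 < (s.card : ℝ) := by exact_mod_cast (L.nonempty_of_mem s hsL).card_pos
  let t : W → ℝ := fun w => if w ∈ s then 1 / (s.card : ℝ) else 0
  have ht : t ∈ cellS s := by
    refine ⟨fun w => ?_, fun w hw => by simp [t, hw], ?_⟩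
    · simp only [t]; split_ifs
      · positivity
      · rfl
    · rw [Finset.sum_congr rfl (g := fun _ => 1 / (s.card : ℝ)) (fun w hw => by simp [t, hw])]
      rw [Finset.sum_const, nsmul_eq_mul]; field_simp
  refine ⟨⟨ptL lam id s t, ptL_mem L hlam id ht hsL fun i hi => hi⟩,
    fun s' => if s' = s then lam else 0, fun s' => ?_, fun s' hs' => ?_, ?_, fun w => ?_⟩
  · beta_reduce; split_ifs <;> linarith
  · by_contra hcc
    apply hs'
    beta_reduce
    rw [if_neg]
    rintro rfl
    exact hcc hs
  · rw [Finset.sum_ite_eq', if_pos hs]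
  · show ptL lam id s t w = _
    rw [ptL_apply, Finset.sum_eq_single s]
    · simp only [id, Finset.sum_ite_eq, t, if_true]
      split_ifs
      · ring
      · rfl
    · intro s' _ hne; simp [hne]
    · intro h; exact absurd hs h

theorem main_ext {V W Y : Type*} (n : ℕ) {K : SComplex V} {L : SComplex W} {κ lam : ℝ} (hκ : 0 < κ)
    (hlam : 0 < lam) (p : C(K.space κ, L.space lam)) (hsurj : Function.Surjective p)
    {φ : V → Finset W}
    (hφ1 : ∀ v : V, ({v} : Finset V) ∈ K.faces → φ v ∈ L.faces)
    (hφ2 : ∀ s ∈ K.faces, ∀ v₁ ∈ s, ∀ v₂ ∈ s, φ v₁ ⊆ φ v₂ ∨ φ v₂ ⊆ φ v₁)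
    (hφ3 : ∀ (x : K.space κ) (w : W),
      (p x : lp (fun _ : W => ℝ) 1) w = (lam / κ) *
          ∑' v : V, (if w ∈ φ v then (x : lp (fun _ : V => ℝ) 1) v / ((φ v).card : ℝ) else 0))
    (hreg : ∀ c : Finset (Finset W), L.IsChainOfFaces c →
      VanishingHomotopyBelow n (p ⁻¹' (L.chainCell lam c)))
    {A : Finset W} (hA : A ∈ L.faces) [MetricSpace Y] (hdim : CovDimLE Y n)
    {B : Set Y} (hB : IsClosed B) (f : Y → lp (fun _ : V => ℝ) 1) (hf : ContinuousOn f B)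
    (hfK : ∀ b ∈ B, f b ∈ (subK K φ A).space κ) :
    ∃ g : Y → lp (fun _ : V => ℝ) 1, Continuous g ∧ (∀ y, g y ∈ (subK K φ A).space κ) ∧
      EqOn g f B := by
  obtain ⟨O, F, hO, hBO, hFc, hFK, hFB⟩ := nbhd_ext (subK K φ A) hκ hB f hf hfK
  obtain ⟨s, hs0, hs1, hs01⟩ := exists_continuous_zero_one_of_isClosed hB hO.isClosed_compl
    (disjoint_compl_right_iff_subset.2 hBO)
  -- a base point
  obtain ⟨y0, hy0⟩ := chainCell_nonempty L hlam (c := {A})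
    ⟨by simp, by simpa using hA, by simp⟩
  obtain ⟨x0, hx0⟩ := hsurj y0
  obtain ⟨sx, hsx, -⟩ := x0.2.2.1
  obtain ⟨v0, -⟩ := K.nonempty_of_mem sx hsx
  -- the cover
  let Ol : Option V → Set Y := fun l => match l with
    | some v => {y | y ∈ O ∧ 0 < F y v}
    | none => {y | 1 / 2 < s y}
  have hOl : ∀ l, IsOpen (Ol l) := by
    rintro (_ | v)
    · exact isOpen_lt continuous_const s.continuous
    · exact ((l1_eval_cont v).comp_continuousOn hFc).isOpen_inter_preimage hO isOpen_Ioi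
  have hOlc : ∀ y, ∃ l, y ∈ Ol l := by
    intro y
    by_cases hy : y ∈ O
    · obtain ⟨S, hSK, hS, -⟩ := space_supp _ hκ (hFK y hy)
      obtain ⟨v, hv⟩ := (subK K φ A).nonempty_of_mem S hSK
      exact ⟨some v, hy, lt_of_le_of_ne ((hFK y hy).1 v) (Ne.symm ((hS v).1 hv))⟩
    · refine ⟨none, ?_⟩
      show 1 / 2 < s y
      rw [hs1 hy]; norm_num
  obtain ⟨R, hRo, hRc, hRr, hRn⟩ := hdim (range Ol) (by rintro _ ⟨l, rfl⟩; exact hOl l) (by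
    rw [eq_univ_iff_forall]
    intro y
    obtain ⟨l, hl⟩ := hOlc y
    exact ⟨Ol l, ⟨l, rfl⟩, hl⟩)
  have hlab : ∀ r : R, ∃ l, (r : Set Y) ⊆ Ol l := by
    intro r
    obtain ⟨_, ⟨l, rfl⟩, hl⟩ := hRr r r.2
    exact ⟨l, hl⟩
  choose lab hlab using hlab
  obtain ⟨ρ, hρ⟩ := PartitionOfUnity.exists_isSubordinate (isClosed_univ (X := Y))
    (fun r : R => (r : Set Y)) (fun r => hRo r r.2) (by
      intro y _
      have : y ∈ ⋃₀ R := by rw [hRc]; trivial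
      obtain ⟨r, hr, hy⟩ := this
      exact mem_iUnion.2 ⟨⟨r, hr⟩, hy⟩)
  let vv : R → V := fun i => (lab i).getD v0
  let N : Set (Finset R) := {S | S.Nonempty ∧ ∃ y, ∀ i ∈ S, y ∈ (i : Set Y)}
  let N1 : Set (Finset R) := {S | S ∈ N ∧ ∀ i ∈ S, lab i ≠ none}
  let vt : Finset R → Finset V := fun S => S.biUnion fun i => (lab i).toFinset
  have hvt : ∀ S v, v ∈ vt S ↔ ∃ i ∈ S, lab i = some v := by
    intro S v
    simp [vt]
  have hvtS : ∀ (S : Finset R) (y : Y), (∀ i ∈ S, y ∈ (i : Set Y)) → ∀ v ∈ vt S, y ∈ O ∧ 0 < F y v := by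
    intro S y hy v hv
    obtain ⟨i, hi, hiv⟩ := (hvt S v).1 hv
    have := hlab i (hy i hi)
    rw [hiv] at this
    exact this
  have hvtK : ∀ S ∈ N, (vt S).Nonempty → vt S ∈ (subK K φ A).faces := by
    rintro S ⟨-, y, hy⟩ ⟨v, hv⟩
    have hyO := (hvtS S y hy v hv).1
    obtain ⟨T, hTK, hT, -⟩ := space_supp _ hκ (hFK y hyO)
    refine (subK K φ A).down_closed T hTK _ (fun u hu => ?_) ⟨v, hv⟩
    exact (hT u).2 (hvtS S y hy u hu).2.ne'
  let cc : Finset R → Finset (Finset W) := fun S =>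
    (vt S).image φ ∪ (if ∃ i ∈ S, lab i = none then {A} else ∅)
  have hcc : ∀ S s, s ∈ cc S ↔ (∃ v ∈ vt S, φ v = s) ∨ ((∃ i ∈ S, lab i = none) ∧ s = A) := by
    intro S s
    simp only [cc, Finset.mem_union, Finset.mem_image]
    by_cases h : ∃ i ∈ S, lab i = none <;> simp [h]
  have hccA : ∀ S ∈ N, ∀ s ∈ cc S, A ⊆ s := by
    intro S hS s hs
    rcases (hcc S s).1 hs with ⟨v, hv, rfl⟩ | ⟨-, rfl⟩
    · exact (hvtK S hS ⟨v, hv⟩).2 v hv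
    · exact subset_rfl
  have hccC : ∀ S ∈ N, L.IsChainOfFaces (cc S) := by
    intro S hS
    refine ⟨?_, ?_, ?_⟩
    · obtain ⟨i, hi⟩ := hS.1
      cases h : lab i with
      | none => exact ⟨A, (hcc S A).2 (Or.inr ⟨⟨i, hi, h⟩, rfl⟩)⟩
      | some v => exact ⟨φ v, (hcc S _).2 (Or.inl ⟨v, (hvt S v).2 ⟨i, hi, h⟩, rfl⟩)⟩
    · intro s hs
      rcases (hcc S s).1 hs with ⟨v, hv, rfl⟩ | ⟨-, rfl⟩
      · exact hφ1 v (K.down_closed _ (hvtK S hS ⟨v, hv⟩).1 {v} (by simpa using hv) (by simp))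
      · exact hA
    · intro s1 hs1 s2 hs2
      have a1 := hccA S hS s1 hs1
      have a2 := hccA S hS s2 hs2
      rcases (hcc S s1).1 hs1 with ⟨v1, hv1, rfl⟩ | ⟨-, rfl⟩
      · rcases (hcc S s2).1 hs2 with ⟨v2, hv2, rfl⟩ | ⟨-, rfl⟩
        · exact hφ2 _ (hvtK S hS ⟨v1, hv1⟩).1 v1 hv1 v2 hv2
        · exact Or.inr a1
      · exact Or.inl a2
  have hvv : ∀ S ∈ N1, ∀ i ∈ S, vv i ∈ vt S := by
    intro S hS i hi
    rw [hvt]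
    refine ⟨i, hi, ?_⟩
    have := hS.2 i hi
    simp only [vv]
    cases h : lab i with
    | none => exact absurd h this
    | some v => rfl
  have hptK : ∀ S ∈ N1, ∀ t ∈ cellS S, ptL κ vv S t ∈ K.space κ := by
    intro S hS t ht
    obtain ⟨i, hi⟩ := hS.1.1
    exact ptL_mem K hκ vv ht (hvtK S hS.1 ⟨_, hvv S hS i hi⟩).1 (hvv S hS)
  let h1 : (R → ℝ) → K.space κ := fun t =>
    if hx : ∃ S, S ∈ N1 ∧ t ∈ cellS S then
      ⟨ptL κ vv hx.choose t, hptK _ hx.choose_spec.1 t hx.choose_spec.2⟩ else x0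
  have hh1 : ∀ S ∈ N1, ∀ t ∈ cellS S, (h1 t : lp (fun _ : V => ℝ) 1) = ptL κ vv S t := by
    intro S hS t ht
    have hx : ∃ S, S ∈ N1 ∧ t ∈ cellS S := ⟨S, hS, ht⟩
    simp only [h1, dif_pos hx]
    exact ptL_eq κ vv hx.choose_spec.2 ht
  obtain ⟨h, hha, hhb⟩ := carrier_ext n N N1
    (by
      rintro S ⟨-, y, hy⟩ T hT hne
      exact ⟨hne, y, fun i hi => hy i (hT hi)⟩)
    (by
      rintro S ⟨⟨-, y, hy⟩, hl⟩ T hT hne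
      exact ⟨⟨hne, y, fun i hi => hy i (hT hi)⟩, fun i hi => hl i (hT hi)⟩)
    (fun S hS => hS.1)
    (by
      rintro S ⟨-, y, hy⟩
      have hsub : ((S.image (fun i : R => (i : Set Y)) : Finset (Set Y)) : Set (Set Y)) ⊆
          {r ∈ R | y ∈ r} := by
        intro r hr
        rw [Finset.mem_coe, Finset.mem_image] at hr
        obtain ⟨i, hi, rfl⟩ := hr
        exact ⟨i.2, hy i hi⟩
      have h2 := Set.ncard_le_ncard hsub (hRn y).1
      rw [Set.ncard_coe_finset, Finset.card_image_of_injective _ Subtype.val_injective] at h2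
      exact h2.trans (hRn y).2)
    (fun S => p ⁻¹' L.chainCell lam (cc S))
    (by
      intro S hS T hT hTS
      refine preimage_mono (chainCell_mono L lam ?_)
      intro s hs
      rw [hcc] at hs ⊢
      rcases hs with ⟨v, hv, rfl⟩ | ⟨⟨i, hi, hi2⟩, rfl⟩
      · left
        obtain ⟨i, hi, hiv⟩ := (hvt T v).1 hv
        exact ⟨v, (hvt S v).2 ⟨i, hTS hi, hiv⟩, rfl⟩
      · exact Or.inr ⟨⟨i, hTS hi, hi2⟩, rfl⟩)
    h1
    (by
      intro S hS
      rw [Topology.IsInducing.subtypeVal.continuousOn_iff]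
      exact (ptL_cont κ vv S).continuousOn.congr fun t ht => hh1 S hS t ht)
    (by
      intro S hS t ht
      refine p_mem_chainCell hκ hlam hφ3 (h1 t) _ fun u hu => ?_
      rw [hh1 S hS t ht] at hu
      obtain ⟨i, hi, rfl⟩ := ptL_supp κ vv hu
      exact (hcc S _).2 (Or.inl ⟨_, hvv S hS i hi, rfl⟩))
    (by
      intro S hS _
      refine ⟨hreg _ (hccC S hS), ?_⟩
      obtain ⟨y, hy⟩ := chainCell_nonempty L hlam (hccC S hS)
      obtain ⟨x, rfl⟩ := hsurj y
      exact ⟨x, hy⟩)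
  have hsuppN : ∀ (y : Y) (S : Finset R), (∀ i, i ∈ S ↔ ρ i y ≠ 0) → S ∈ N := by
    intro y S hS
    refine ⟨cellS_nonempty_of_mem (pou_mem_cell ρ y S fun i hi => (hS i).2 hi), y, fun i hi => ?_⟩
    exact hρ i (subset_tsupport _ ((hS i).1 hi))
  have hex : ∀ y : Y, ∃ S : Finset R, ∀ i, i ∈ S ↔ ρ i y ≠ 0 := by
    intro y
    have hfin : {i | ρ i y ≠ 0}.Finite := ρ.locallyFinite.point_finite y
    exact ⟨hfin.toFinset, fun i => by simp⟩
  let k : Y → K.space κ := fun y => h (fun i => ρ i y)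
  have hk : Continuous k := pou_comp_cont ρ h fun y S hS => (hhb S (hsuppN y S hS)).1
  have hkK : ∀ y, (k y : lp (fun _ : V => ℝ) 1) ∈ (subK K φ A).space κ := by
    intro y
    obtain ⟨S, hS⟩ := hex y
    have hSN := hsuppN y S hS
    have hm := (hhb S hSN).2 (pou_mem_cell ρ y S fun i hi => (hS i).2 hi)
    refine (bst_inter hκ hlam hφ1 hφ2 hφ3 hA (k y)).2 fun a ha => ?_
    have hwf := L.down_closed _ hA {a} (by simpa using ha) (by simp)
    exact bst_of_chain L hlam (hccC S hSN) hwf (fun s hs => hccA S hSN s hs ha) hm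
  let τ : Y → ℝ := fun y => max (1 - 2 * s y) 0
  have hτ : Continuous τ := (continuous_const.sub (continuous_const.mul s.continuous)).max
    continuous_const
  have hτ0 : ∀ y, 0 ≤ τ y := fun y => le_max_right _ _
  have hτ1 : ∀ y, τ y ≤ 1 := fun y => max_le (by linarith [(hs01 y).1]) zero_le_one
  have hkc : Continuous fun y => (k y : lp (fun _ : V => ℝ) 1) := continuous_subtype_val.comp hk
  refine ⟨fun y => τ y • F y + (1 - τ y) • (k y : lp (fun _ : V => ℝ) 1), ?_, ?_, ?_⟩
  · rw [continuous_iff_continuousAt]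
    intro y
    by_cases hy : y ∈ O
    · have hFy := hFc.continuousAt (hO.mem_nhds hy)
      exact (hτ.continuousAt.smul hFy).add
        ((continuousAt_const.sub hτ.continuousAt).smul hkc.continuousAt)
    · refine hkc.continuousAt.congr ?_
      have hop : IsOpen {y | 1 / 2 < s y} := isOpen_lt continuous_const s.continuous
      have hmem : 1 / 2 < s y := by rw [hs1 hy]; norm_num
      filter_upwards [hop.mem_nhds hmem] with z hz
      have hz' : 1 / 2 < s z := hz
      have : τ z = 0 := max_eq_right (by linarith)
      rw [this]; simp
  · intro y
    by_cases hty : τ y = 0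
    · beta_reduce
      rw [hty]
      simpa using hkK y
    · have hsy : s y < 1 / 2 := by
        by_contra hc
        exact hty (max_eq_right (by linarith))
      have hyO : y ∈ O := by
        by_contra hc
        rw [hs1 hc] at hsy
        norm_num at hsy
      obtain ⟨S, hS⟩ := hex y
      have hSN := hsuppN y S hS
      have hyS : ∀ i ∈ S, y ∈ (i : Set Y) := fun i hi => hρ i (subset_tsupport _ ((hS i).1 hi))
      have hS1 : S ∈ N1 := by
        refine ⟨hSN, fun i hi hl => ?_⟩
        have h2 := hlab i (hyS i hi)
        rw [hl] at h2
        have h3 : 1 / 2 < s y := h2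
        linarith
      have hcell := pou_mem_cell ρ y S fun i hi => (hS i).2 hi
      have hky : (k y : lp (fun _ : V => ℝ) 1) = ptL κ vv S (fun i => ρ i y) := by
        rw [← hh1 S hS1 _ hcell, ← hha S hS1 hcell]
      have hFy := hFK y hyO
      have hkk := hkK y
      obtain ⟨T, hTK, hTs⟩ := hFy.2.1
      refine ⟨fun v => ?_, ⟨T, hTK, fun v hv => ?_⟩, ?_⟩
      · show 0 ≤ τ y * F y v + (1 - τ y) * (k y : lp (fun _ : V => ℝ) 1) v
        have := hFy.1 v
        have := hkk.1 v
        have := hτ0 y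
        have := sub_nonneg.2 (hτ1 y)
        positivity
      · by_cases hFv : F y v = 0
        · exfalso
          have hkv : (k y : lp (fun _ : V => ℝ) 1) v ≠ 0 := by
            intro hc
            apply hv
            show τ y * F y v + (1 - τ y) * (k y : lp (fun _ : V => ℝ) 1) v = 0
            rw [hFv, hc]; simp
          rw [hky] at hkv
          obtain ⟨i, hi, rfl⟩ := ptL_supp κ vv hkv
          exact (hvtS S y hyS _ (hvv S hS1 i hi)).2.ne' hFv
        · exact hTs v hFv
      · have := (hFy.2.2.mul_left (τ y)).add (hkk.2.2.mul_left (1 - τ y))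
        rw [show τ y * κ + (1 - τ y) * κ = κ by ring] at this
        exact this
  · intro b hb
    have : τ b = 1 := by simp only [τ]; rw [hs0 hb]; simp
    beta_reduce
    rw [this, hFB hb]; simp

end mainpart

/-- If a quasi-simplicial map `p : K → L` of polyhedra is surjective and
`n`-regular, then the pull-back `p⁻¹(ℬ_L)` of the cover of `L` by barycentric stars of
vertices is an `AE(n)`-cover of `K`. -/
theorem statement3 {V W : Type*} (n : ℕ) (K : SComplex V) (L : SComplex W)
    (κ lam : ℝ) (hκ : 0 < κ) (hlam : 0 < lam)
    (p : C((K.space κ), (L.space lam)))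
    (hsurj : Function.Surjective p)
    (hreg : SComplex.IsNRegularMap n K L κ lam p) :
    IsAECover.{u} n
      (fun v : {v : W // ({v} : Finset W) ∈ L.faces} =>
        p ⁻¹' (L.bstVertex lam v.1)) := by
  obtain ⟨⟨φ, hφ1, hφ2, hφ3⟩, hvan⟩ := hreg
  refine ⟨?_, ?_⟩
  · refine eq_univ_iff_forall.2 fun x => ?_
    obtain ⟨w, hw, hx⟩ := bst_cover hκ hlam hφ1 hφ2 hφ3 x
    exact mem_iUnion.2 ⟨⟨w, hw⟩, hx⟩
  · intro J hJ
    rcases Set.eq_empty_or_nonempty (⋂ i ∈ J,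
      (fun v : {v : W // ({v} : Finset W) ∈ L.faces} => p ⁻¹' (L.bstVertex lam v.1)) i) with h | hne
    · exact Or.inl h
    · right
      obtain ⟨x, hx⟩ := hne
      have hx' : ∀ j ∈ J, p x ∈ L.bstVertex lam j.1 := fun j hj => mem_iInter₂.1 hx j hj
      obtain ⟨S, hSK, hS, -⟩ := space_supp K hκ x.2
      obtain ⟨u, hu⟩ := K.nonempty_of_mem S hSK
      have huL := hφ1 u (K.down_closed S hSK {u} (by simpa using hu) (by simp))
      let A : Finset W := (φ u).filter fun w => ∃ j ∈ J, j.1 = w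
      have hAmem : ∀ w, w ∈ A ↔ ∃ j ∈ J, j.1 = w := by
        intro w
        simp only [A, Finset.mem_filter]
        refine ⟨fun h => h.2, fun h => ⟨?_, h⟩⟩
        obtain ⟨j, hj, rfl⟩ := h
        exact mem_of_bst hκ hlam hφ1 hφ2 hφ3 x (hx' j hj) u ((hS u).1 hu)
      have hA : A ∈ L.faces := by
        refine L.down_closed _ huL A (Finset.filter_subset _ _) ?_
        obtain ⟨j, hj⟩ := hJ
        exact ⟨j.1, (hAmem _).2 ⟨j, hj, rfl⟩⟩
      have hiff : ∀ z : K.space κ, z ∈ (⋂ i ∈ J, (fun v : {v : W // ({v} : Finset W) ∈ L.faces} =>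
          p ⁻¹' (L.bstVertex lam v.1)) i) ↔
          (z : lp (fun _ : V => ℝ) 1) ∈ (subK K φ A).space κ := by
        intro z
        rw [bst_inter hκ hlam hφ1 hφ2 hφ3 hA z, mem_iInter₂]
        constructor
        · intro h a ha
          obtain ⟨j, hj, rfl⟩ := (hAmem a).1 ha
          exact h j hj
        · intro h j hj
          exact h j.1 ((hAmem _).2 ⟨j, hj, rfl⟩)
      intro Y _ hdim B hB f
      let f0 : Y → lp (fun _ : V => ℝ) 1 := fun y =>
        if hy : y ∈ B then ((f ⟨y, hy⟩ : K.space κ) : lp (fun _ : V => ℝ) 1) else 0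
      have hf0 : ∀ b : B, f0 b = ((f b : K.space κ) : lp (fun _ : V => ℝ) 1) := fun b => by
        simp only [f0, dif_pos b.2]
      obtain ⟨g, hgc, hgK, hgB⟩ := main_ext n hκ hlam p hsurj hφ1 hφ2 hφ3 hvan hA hdim hB f0 (by
          rw [continuousOn_iff_continuous_domRestrict]
          refine (continuous_subtype_val.comp (continuous_subtype_val.comp f.continuous)).congr ?_
          intro b
          rw [domRestrict_apply, hf0 b]
          rfl) (by
          intro b hb
          rw [hf0 ⟨b, hb⟩]
          exact (hiff _).1 (f ⟨b, hb⟩).2)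
      refine ⟨⟨fun y => ⟨⟨g y, ((mem_subK hκ).1 (hgK y)).1⟩, (hiff _).2 (hgK y)⟩, ?_⟩, ?_⟩
      · exact (hgc.subtype_mk _).subtype_mk _
      · intro b
        apply Subtype.ext
        apply Subtype.ext
        show g b = _
        rw [hgB b.2, hf0 b]
end

section
/- If K is a full subpolyhedron of a polyhedron L, then K is a deformation retract of its barycentric star bst_L K. -/
open Set Metric unitInterval
open scoped ENNReal Classical

namespace St4

lemma layer {V : Type*} (a : V) : ∀ (n : ℕ) (S : Finset V) (f : V → ℝ), S.card = n → a ∈ S →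
    (∀ v, 0 ≤ f v) → (∀ v, f v ≠ 0 → v ∈ S) → (∀ v, f v ≤ f a) →
    ∃ (c : Finset (Finset V)) (t : Finset V → ℝ), {a} ∈ c ∧ (∀ s ∈ c, a ∈ s ∧ s ⊆ S) ∧
      (∀ s₁ ∈ c, ∀ s₂ ∈ c, s₁ ⊆ s₂ ∨ s₂ ⊆ s₁) ∧ (∀ s, 0 ≤ t s) ∧ (∀ s, t s ≠ 0 → s ∈ c) ∧
      (∑ s ∈ c, t s) = ∑ v ∈ S, f v ∧
      ∀ w, f w = ∑ s ∈ c, (if w ∈ s then t s / (s.card : ℝ) else 0) := by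
  intro n
  induction n with
  | zero =>
    intro S f hS ha
    rw [Finset.card_eq_zero] at hS
    simp [hS] at ha
  | succ n ih =>
    intro S f hS ha h0 hsupp hmax
    by_cases hSa : S.erase a = ∅
    · have hSe : S = {a} := by
        ext v
        by_cases hv : v = a
        · simp [hv, ha]
        · have : v ∉ S.erase a := by simp [hSa]
          simpa [hv] using this
      subst hSe
      refine ⟨{{a}}, fun s => if s = {a} then f a else 0, by simp, by simp, by simp, ?_, ?_, by simp, ?_⟩
      · intro s
        dsimp only
        split_ifs
        · exact h0 a
        · exact le_rfl
      · intro s hs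
        by_contra h
        simp at h
        simp [h] at hs
      · intro w
        simp only [Finset.sum_singleton, Finset.mem_singleton]
        by_cases hw : w = a
        · simp [hw]
        · simp only [hw, if_false]
          by_contra h
          exact hw (by simpa using hsupp w h)
    · obtain ⟨v, hv, hmin⟩ := Finset.exists_min_image (S.erase a) f
        (Finset.nonempty_iff_ne_empty.mpr hSa)
      have hva : v ≠ a := Finset.ne_of_mem_erase hv
      have hvS : v ∈ S := Finset.mem_of_mem_erase hv
      have hminS : ∀ w ∈ S, f v ≤ f w := by
        intro w hw
        by_cases hwa : w = a
        · rw [hwa]; exact hmax v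
        · exact hmin w (Finset.mem_erase.mpr ⟨hwa, hw⟩)
      obtain ⟨c, t, hac, hcS, hch, ht0, htc, hsum, hf⟩ := ih (S.erase v)
        (fun w => if w ∈ S then f w - f v else 0)
        (by rw [Finset.card_erase_of_mem hvS, hS]; rfl)
        (Finset.mem_erase.mpr ⟨hva.symm, ha⟩)
        (by
          intro w
          split_ifs with h
          · linarith [hminS w h]
          · exact le_rfl)
        (by
          intro w hw
          split_ifs at hw with h
          · refine Finset.mem_erase.mpr ⟨?_, h⟩
            rintro rfl
            simp at hw
          · exact absurd rfl hw)
        (by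
          intro w
          simp only [ha, if_true]
          split_ifs with h
          · linarith [hmax w]
          · linarith [hmax v])
      have hSc : S ∉ c := by
        intro h
        have := (hcS S h).2 hvS
        simp at this
      have hcard : (S.card : ℝ) ≠ 0 := by rw [hS]; positivity
      have hne : ∀ s ∈ c, s ≠ S := fun s hs h => hSc (h ▸ hs)
      refine ⟨insert S c, fun s => if s = S then f v * S.card else t s, by simp [hac], ?_, ?_, ?_, ?_, ?_, ?_⟩
      · intro s hs
        rcases Finset.mem_insert.mp hs with rfl | hs
        · exact ⟨ha, subset_rfl⟩
        · exact ⟨(hcS s hs).1, (hcS s hs).2.trans (Finset.erase_subset _ _)⟩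
      · intro s hs s' hs'
        rcases Finset.mem_insert.mp hs with rfl | hs
        · rcases Finset.mem_insert.mp hs' with rfl | hs'
          · exact Or.inl subset_rfl
          · exact Or.inr ((hcS s' hs').2.trans (Finset.erase_subset _ _))
        · rcases Finset.mem_insert.mp hs' with h | hs'
          · rw [h]
            exact Or.inl ((hcS s hs).2.trans (Finset.erase_subset _ _))
          · exact hch s hs s' hs'
      · intro s
        dsimp only
        split_ifs
        · exact mul_nonneg (h0 v) (Nat.cast_nonneg _)
        · exact ht0 s
      · intro s hs
        dsimp only at hs
        split_ifs at hs with h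
        · simp [h]
        · exact Finset.mem_insert_of_mem (htc s hs)
      · rw [Finset.sum_insert hSc]
        have h1 : ∑ s ∈ c, (if s = S then f v * S.card else t s) = ∑ s ∈ c, t s :=
          Finset.sum_congr rfl fun s hs => by rw [if_neg (hne s hs)]
        rw [h1, hsum, if_pos rfl]
        have h2 : ∑ w ∈ S.erase v, (if w ∈ S then f w - f v else 0) = ∑ w ∈ S, (f w - f v) := by
          rw [← Finset.add_sum_erase S _ hvS]
          rw [sub_self, zero_add]
          exact Finset.sum_congr rfl fun w hw => by rw [if_pos (Finset.mem_of_mem_erase hw)]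
        rw [h2, Finset.sum_sub_distrib]
        simp
        ring
      · intro w
        rw [Finset.sum_insert hSc]
        have h1 : ∑ s ∈ c, (if w ∈ s then (if s = S then f v * S.card else t s) / (s.card : ℝ) else 0)
            = ∑ s ∈ c, (if w ∈ s then t s / (s.card : ℝ) else 0) :=
          Finset.sum_congr rfl fun s hs => by rw [if_neg (hne s hs)]
        rw [h1, ← hf w]
        by_cases hw : w ∈ S
        · simp only [hw, if_true]
          field_simp
          ring
        · simp only [hw, if_false, add_zero]
          by_contra h
          exact hw (hsupp w h)

variable {V : Type*} (L : SComplex V) (κ : ℝ) (F : Set (Finset V))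

lemma bst_max (hκ : 0 < κ) (hsub : L.IsSubcomplex F) (y : L.space κ) (hy : y ∈ L.bst κ F) :
    ∃ a, ({a} : Finset V) ∈ F ∧ ∀ v, y.1 v ≤ y.1 a := by
  simp only [SComplex.bst, mem_iUnion, mem_setOf_eq] at hy
  obtain ⟨c, ⟨⟨hcne, hcf, hch⟩, z, ⟨t, ht0, htc, hts, hz⟩, s1, hs1, hzs1⟩, ⟨u, hu0, huc, hus, hyu⟩⟩ := hy
  obtain ⟨s, hsc, hts⟩ : ∃ s ∈ c, t s ≠ 0 := by
    by_contra! h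
    rw [Finset.sum_eq_zero h] at hts
    exact hκ.ne hts
  obtain ⟨s0, hs0, hmin⟩ := Finset.exists_min_image c Finset.card hcne
  have hs0sub : ∀ s ∈ c, s0 ⊆ s := by
    intro s hs
    rcases hch s0 hs0 s hs with h | h
    · exact h
    · exact (Finset.eq_of_subset_of_card_le h (hmin s hs)).symm.subset
  obtain ⟨a, ha⟩ := L.nonempty_of_mem s0 (hcf s0 hs0)
  refine ⟨a, ?_, ?_⟩
  · apply hsub.2 s1 hs1 _ _ (Finset.singleton_nonempty a)
    rw [Finset.singleton_subset_iff]
    apply hzs1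
    rw [hz]
    refine ne_of_gt (Finset.sum_pos' ?_ ⟨s, hsc, ?_⟩)
    · intro i _
      split_ifs
      · exact div_nonneg (ht0 i) (Nat.cast_nonneg _)
      · exact le_rfl
    · have has := hs0sub s hsc ha
      rw [if_pos has]
      exact div_pos (lt_of_le_of_ne (ht0 s) hts.symm) (Nat.cast_pos.mpr (Finset.card_pos.mpr ⟨a, has⟩))
  · intro v
    rw [hyu, hyu]
    apply Finset.sum_le_sum
    intro i hi
    rw [if_pos (hs0sub i hi ha)]
    split_ifs
    · exact le_rfl
    · exact div_nonneg (hu0 i) (Nat.cast_nonneg _)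

lemma pos_of_max (hκ : 0 < κ) (y : L.space κ) (a : V) (hmax : ∀ v, y.1 v ≤ y.1 a) : 0 < y.1 a := by
  refine lt_of_le_of_ne (y.2.1 a) fun h => ?_
  have h0 : (fun v => y.1 v) = fun _ => 0 := by
    funext v
    exact le_antisymm (h ▸ hmax v) (y.2.1 v)
  have hs := y.2.2.2
  rw [h0] at hs
  exact hκ.ne (hasSum_zero.unique hs)

lemma max_bst (hκ : 0 < κ) (hsub : L.IsSubcomplex F) (y : L.space κ) (a : V)
    (haF : ({a} : Finset V) ∈ F) (hmax : ∀ v, y.1 v ≤ y.1 a) : y ∈ L.bst κ F := by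
  have hpos := pos_of_max L κ hκ y a hmax
  obtain ⟨S, hS, hyS⟩ := y.2.2.1
  obtain ⟨c, t, hac, hcS, hch, ht0, htc, hsum, hf⟩ :=
    layer a S.card S (fun v => y.1 v) rfl (hyS a hpos.ne') y.2.1 hyS hmax
  have hk : ∑ v ∈ S, y.1 v = κ := by
    refine (hasSum_sum_of_ne_finset_zero ?_).unique y.2.2.2
    intro b hb
    by_contra h
    exact hb (hyS b h)
  simp only [SComplex.bst, mem_iUnion, mem_setOf_eq]
  refine ⟨c, ⟨⟨⟨_, hac⟩, ?_, hch⟩, ?_⟩, t, ht0, htc, hsum.trans hk, hf⟩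
  · intro s hs
    exact L.down_closed S hS s (hcS s hs).2 ⟨a, (hcS s hs).1⟩
  · have hcoe : ∀ v, (lp.single 1 a κ : lp (fun _ : V => ℝ) 1) v = if v = a then κ else 0 := by
      intro v
      by_cases h : v = a
      · subst h; simp
      · simp [lp.single_apply, h]
    refine ⟨⟨lp.single 1 a κ, ?_, ⟨{a}, hsub.1 haF, ?_⟩, ?_⟩, ⟨fun s => if s = {a} then κ else 0, ?_, ?_, ?_, ?_⟩, {a}, haF, ?_⟩
    · intro v; rw [hcoe]; split_ifs <;> [exact hκ.le; exact le_rfl]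
    · intro v hv; rw [hcoe] at hv; by_contra h; simp at h; simp [h] at hv
    · simp only [hcoe]; exact hasSum_ite_eq a κ
    · intro s; dsimp only; split_ifs <;> [exact hκ.le; exact le_rfl]
    · intro s hs
      dsimp only at hs
      split_ifs at hs with h
      · rw [h]; exact hac
      · exact absurd rfl hs
    · rw [Finset.sum_ite_eq' c, if_pos hac]
    · intro w
      rw [Finset.sum_eq_single {a}]
      · simpa using hcoe w
      · intro s _ hs
        simp [hs]
      · intro h; exact absurd hac h
    · intro v hv
      change (lp.single 1 a κ : lp (fun _ : V => ℝ) 1) v ≠ 0 at hv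
      rw [hcoe] at hv; by_contra h; simp at h; simp [h] at hv

/-- Restriction to the vertices of the subcomplex. -/
noncomputable def restr (x : lp (fun _ : V => ℝ) 1) : lp (fun _ : V => ℝ) 1 :=
  ⟨fun v => if ({v} : Finset V) ∈ F then x v else 0, by
    refine (lp.memℓp x).mono' (F := fun _ => ℝ) fun v => ?_
    split_ifs <;> simp⟩

lemma restr_apply (x : lp (fun _ : V => ℝ) 1) (v : V) :
    restr F x v = if ({v} : Finset V) ∈ F then x v else 0 := rfl

lemma continuous_restr : Continuous (restr (V := V) F) := by
  refine (LipschitzWith.of_dist_le_mul (K := 1) fun x y => ?_).continuous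
  rw [dist_eq_norm, dist_eq_norm, NNReal.coe_one, one_mul]
  refine lp.norm_mono one_ne_zero fun v => ?_
  simp only [lp.coeFn_sub, Pi.sub_apply, restr_apply]
  split_ifs <;> simp

lemma hasSum_restr (x : lp (fun _ : V => ℝ) 1) (hx : ∀ v, 0 ≤ x v) :
    HasSum (fun v => restr F x v) ‖restr F x‖ := by
  have h := lp.hasSum_norm (p := 1) (by simp) (restr F x)
  simp only [ENNReal.toReal_one, Real.rpow_one] at h
  convert h using 2 with v
  rw [Real.norm_of_nonneg]
  rw [restr_apply]
  split_ifs
  · exact hx v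
  · exact le_rfl

/-- The straight-line homotopy. -/
noncomputable def hom (x : lp (fun _ : V => ℝ) 1) (t : ℝ) : lp (fun _ : V => ℝ) 1 :=
  (1 - t) • x + (t * κ / ‖restr F x‖) • restr F x

lemma hom_apply (x : lp (fun _ : V => ℝ) 1) (t : ℝ) (v : V) :
    hom κ F x t v = (1 - t) * x v + (t * κ / ‖restr F x‖) * restr F x v := rfl

end St4

/-- If `K` is a full subpolyhedron of a polyhedron `L`, then `K` is a
deformation retract of its barycentric star `bst_L K`. -/
theorem statement4 {V : Type*} (L : SComplex V) (κ : ℝ) (hκ : 0 < κ)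
    (F : Set (Finset V)) (hsub : L.IsSubcomplex F)
    (hfull : ∀ s ∈ L.faces, (∀ v ∈ s, ({v} : Finset V) ∈ F) → s ∈ F) :
    IsDeformationRetractOf (L.subSpace κ F) (L.bst κ F) := by
  classical
  have hne : ∀ b : L.bst κ F, ‖St4.restr F b.1.1‖ ≠ 0 := by
    intro b h
    obtain ⟨a, ha, hmax⟩ := St4.bst_max L κ F hκ hsub b.1 b.2
    have hp := St4.pos_of_max L κ hκ b.1 a hmax
    have h2 : St4.restr F b.1.1 a = 0 := by
      rw [norm_eq_zero.mp h]; rfl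
    rw [St4.restr_apply, if_pos ha] at h2
    exact hp.ne' h2
  have hrn : ∀ (b : L.bst κ F) v, 0 ≤ St4.restr F b.1.1 v := by
    intro b v
    rw [St4.restr_apply]
    split_ifs
    · exact b.1.2.1 v
    · exact le_rfl
  have hco : ∀ (b : L.bst κ F) (t : unitInterval), 0 ≤ (t : ℝ) * κ / ‖St4.restr F b.1.1‖ :=
    fun b t => div_nonneg (mul_nonneg t.2.1 hκ.le) (norm_nonneg _)
  have hmem : ∀ (b : L.bst κ F) (t : unitInterval), St4.hom κ F b.1.1 t ∈ L.space κ := by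
    intro b t
    refine ⟨?_, ?_, ?_⟩
    · intro v
      rw [St4.hom_apply]
      exact add_nonneg (mul_nonneg (sub_nonneg.mpr t.2.2) (b.1.2.1 v)) (mul_nonneg (hco b t) (hrn b v))
    · obtain ⟨s, hs, hbs⟩ := b.1.2.2.1
      refine ⟨s, hs, fun v hv => hbs v fun h0 => hv ?_⟩
      rw [St4.hom_apply, St4.restr_apply, h0]
      simp
    · have h := (b.1.2.2.2.mul_left (1 - (t : ℝ))).add
        ((St4.hasSum_restr F b.1.1 b.1.2.1).mul_left ((t : ℝ) * κ / ‖St4.restr F b.1.1‖))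
      have e : (1 - (t : ℝ)) * κ + (t : ℝ) * κ / ‖St4.restr F b.1.1‖ * ‖St4.restr F b.1.1‖ = κ := by
        rw [div_mul_cancel₀ _ (hne b)]
        ring
      rw [e] at h
      exact h
  have hAB : L.subSpace κ F ⊆ L.bst κ F := by
    rintro y ⟨s, hs, hys⟩
    obtain ⟨a, ha, hmax⟩ := Finset.exists_max_image s (fun v => y.1 v)
      (L.nonempty_of_mem s (hsub.1 hs))
    refine St4.max_bst L κ F hκ hsub y a (hsub.2 s hs _ (by simpa using ha) (by simp)) fun v => ?_
    by_cases hv : v ∈ s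
    · exact hmax v hv
    · have : y.1 v = 0 := by
        by_contra h
        exact hv (hys v h)
      rw [this]
      exact y.2.1 a
  refine ⟨hAB, ⟨fun p => ⟨St4.hom κ F p.1.1.1 p.2, hmem p.1 p.2⟩, ?_⟩, ?_, ?_, ?_, ?_⟩
  · refine Continuous.subtype_mk ?_ _
    have c1 : Continuous fun p : L.bst κ F × unitInterval => (p.1.1.1 : lp (fun _ : V => ℝ) 1) :=
      continuous_subtype_val.comp (continuous_subtype_val.comp continuous_fst)
    have c2 : Continuous fun p : L.bst κ F × unitInterval => (p.2 : ℝ) :=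
      continuous_subtype_val.comp continuous_snd
    have c3 := (St4.continuous_restr F).comp c1
    exact ((continuous_const.sub c2).smul c1).add
      (((c2.mul continuous_const).div c3.norm fun p => hne p.1).smul c3)
  · intro b
    apply Subtype.ext
    change St4.hom κ F b.1.1 (0 : ℝ) = b.1.1
    simp [St4.hom]
  · intro b
    obtain ⟨s, hs, hbs⟩ := b.1.2.2.1
    have key : ∀ v, St4.hom κ F b.1.1 (1 : ℝ) v ≠ 0 → v ∈ s ∧ ({v} : Finset V) ∈ F := by
      intro v hv
      rw [St4.hom_apply, St4.restr_apply] at hv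
      split_ifs at hv with h
      · refine ⟨hbs v fun h0 => hv ?_, h⟩
        rw [h0]; simp
      · simp at hv
    obtain ⟨a, ha, hmax⟩ := St4.bst_max L κ F hκ hsub b.1 b.2
    have hp := St4.pos_of_max L κ hκ b.1 a hmax
    refine ⟨s.filter fun v => ({v} : Finset V) ∈ F, ?_, ?_⟩
    · refine hfull _ (L.down_closed s hs _ (Finset.filter_subset _ _)
        ⟨a, Finset.mem_filter.mpr ⟨hbs a hp.ne', ha⟩⟩) ?_
      intro v hv
      exact (Finset.mem_filter.mp hv).2
    · intro v hv
      exact Finset.mem_filter.mpr (key v hv)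
  · intro b t
    obtain ⟨a, ha, hmax⟩ := St4.bst_max L κ F hκ hsub b.1 b.2
    refine St4.max_bst L κ F hκ hsub _ a ha fun v => ?_
    change St4.hom κ F b.1.1 t v ≤ St4.hom κ F b.1.1 t a
    rw [St4.hom_apply, St4.hom_apply]
    refine add_le_add (mul_le_mul_of_nonneg_left (hmax v) (sub_nonneg.mpr t.2.2))
      (mul_le_mul_of_nonneg_left ?_ (hco b t))
    rw [St4.restr_apply, St4.restr_apply, if_pos ha]
    split_ifs
    · exact hmax v
    · exact b.1.2.1 a
  · rintro b ⟨s, hs, hbs⟩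
    have hr : St4.restr F b.1.1 = b.1.1 := by
      apply lp.ext
      funext v
      rw [St4.restr_apply]
      split_ifs with h
      · rfl
      · by_contra h0
        exact h (hsub.2 s hs _ (by simpa using hbs v (Ne.symm h0)) (by simp))
    have hn : ‖b.1.1‖ = κ := by
      have h := St4.hasSum_restr F b.1.1 b.1.2.1
      rw [hr] at h
      exact h.unique b.1.2.2.2
    apply Subtype.ext
    change St4.hom κ F b.1.1 (1 : ℝ) = b.1.1
    simp [St4.hom, hr, hn, hκ.ne']
end

section
/- If K is a full subpolyhedron of a polyhedron L, then K is a deformation retract of its open star ost_L K. -/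
open Set Metric unitInterval
open scoped ENNReal Classical

namespace SComplex

/-- Restriction of an `ℓ¹` function to a set of coordinates, as a continuous linear map. -/
noncomputable def restrP {V : Type*} (S : Set V) :
    lp (fun _ : V => ℝ) 1 →L[ℝ] lp (fun _ : V => ℝ) 1 :=
  LinearMap.mkContinuous
    { toFun := fun x => ⟨fun v => if v ∈ S then x v else 0, by
        refine Memℓp.mono' (lp.memℓp x) (fun v => ?_)
        by_cases h : v ∈ S <;> simp [h]⟩
      map_add' := fun x y => by
        ext v
        change (if v ∈ S then x v + y v else 0) =
          (if v ∈ S then x v else 0) + (if v ∈ S then y v else 0)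
        by_cases h : v ∈ S <;> simp [h]
      map_smul' := fun c x => by
        ext v
        by_cases h : v ∈ S <;> simp [h] }
    1 (fun x => by
      rw [one_mul]
      refine lp.norm_mono (by simp) (fun v => ?_)
      by_cases h : v ∈ S <;> simp [h])

theorem restrP_apply {V : Type*} (S : Set V) (x : lp (fun _ : V => ℝ) 1) (v : V) :
    restrP S x v = if v ∈ S then x v else 0 := rfl

theorem hasSum_norm_of_nonneg {V : Type*} (x : lp (fun _ : V => ℝ) 1) (hx : ∀ v, 0 ≤ x v) :
    HasSum (fun v => x v) ‖x‖ := by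
  have h := lp.hasSum_norm (p := 1) (by simp) x
  simpa [abs_of_nonneg (hx _)] using h

theorem exists_ne_zero {V : Type*} (L : SComplex V) {κ : ℝ} (hκ : 0 < κ) (x : L.space κ) :
    ∃ v, (x : lp (fun _ : V => ℝ) 1) v ≠ 0 := by
  by_contra! h
  have h2 := x.2.2.2
  simp only [h] at h2
  exact hκ.ne (hasSum_zero.unique h2)

theorem mem_ost_iff {V : Type*} (L : SComplex V) {κ : ℝ} (hκ : 0 < κ)
    (F : Set (Finset V)) (hsub : L.IsSubcomplex F) (x : L.space κ) :
    x ∈ L.ost κ F ↔ ∃ v, ({v} : Finset V) ∈ F ∧ (x : lp (fun _ : V => ℝ) 1) v ≠ 0 := by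
  constructor
  · intro hx
    by_contra! hno
    apply hx
    obtain ⟨s, hs, hxs⟩ := x.2.2.1
    obtain ⟨w, hw⟩ := exists_ne_zero L hκ x
    simp only [mem_iUnion]
    refine ⟨s.filter (fun v => (x : lp (fun _ : V => ℝ) 1) v ≠ 0), ⟨?_, ?_⟩, ?_⟩
    · exact L.down_closed s hs _ (Finset.filter_subset _ _)
        ⟨w, Finset.mem_filter.2 ⟨hxs w hw, hw⟩⟩
    · rw [Set.eq_empty_iff_forall_notMem]
      rintro y ⟨hy1, s', hs', hy2⟩
      obtain ⟨u, hu⟩ := exists_ne_zero L hκ y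
      have h1 := hy1 u hu
      have h2 := hy2 u hu
      exact (Finset.mem_filter.1 h1).2
        (hno u (hsub.2 s' hs' {u} (by simpa using h2) (Finset.singleton_nonempty u)))
    · intro v hv
      exact Finset.mem_filter.2 ⟨hxs v hv, hv⟩
  · rintro ⟨v, hv, hxv⟩ hx
    simp only [mem_iUnion] at hx
    obtain ⟨s, ⟨hs, hdis⟩, hxs⟩ := hx
    have hvs := hxs v hxv
    have hsupp : ∀ w, (lp.single 1 v κ : lp (fun _ : V => ℝ) 1) w ≠ 0 → w = v := by
      intro w hw
      by_contra hne
      exact hw (lp.single_apply_ne (E := fun _ : V => ℝ) 1 v κ hne)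
    have hy : (lp.single 1 v κ : lp (fun _ : V => ℝ) 1) ∈ L.space κ := by
      refine ⟨fun w => ?_, ⟨s, hs, fun w hw => ?_⟩, ?_⟩
      · by_cases h : w = v
        · subst h
          rw [lp.single_apply_self]
          exact hκ.le
        · rw [lp.single_apply_ne (E := fun _ : V => ℝ) 1 v κ h]
      · rw [hsupp w hw]
        exact hvs
      · have := hasSum_single (f := fun w => (lp.single 1 v κ : lp (fun _ : V => ℝ) 1) w) v
          (fun w hw => lp.single_apply_ne (E := fun _ : V => ℝ) 1 v κ hw)
        simpa only [lp.single_apply_self] using this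
    have : (⟨_, hy⟩ : L.space κ) ∈ L.cell κ s ∩ L.subSpace κ F := by
      refine ⟨fun w hw => ?_, {v}, hv, fun w hw => ?_⟩
      · rw [hsupp w hw]
        exact hvs
      · rw [hsupp w hw]
        simp
    rw [hdis] at this
    exact this

end SComplex

open SComplex

/-- If `K` is a full subpolyhedron of a polyhedron `L`, then `K` is a
deformation retract of its open star `ost_L K`. -/
theorem statement5 {V : Type*} (L : SComplex V) (κ : ℝ) (hκ : 0 < κ)
    (F : Set (Finset V)) (hsub : L.IsSubcomplex F)
    (hfull : ∀ s ∈ L.faces, (∀ v ∈ s, ({v} : Finset V) ∈ F) → s ∈ F) :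
    IsDeformationRetractOf (L.subSpace κ F) (L.ost κ F) := by
  set S : Set V := {v | ({v} : Finset V) ∈ F} with hS
  have hSmem : ∀ v, v ∈ S ↔ ({v} : Finset V) ∈ F := fun v => Iff.rfl
  have hnn : ∀ (x : L.space κ) v, 0 ≤ restrP S x.1 v := by
    intro x v
    rw [restrP_apply]
    split_ifs
    · exact x.2.1 v
    · exact le_rfl
  have hpos : ∀ x ∈ L.ost κ F, 0 < ‖restrP S x.1‖ := by
    intro x hx
    obtain ⟨v, hv, hxv⟩ := (mem_ost_iff L hκ F hsub x).1 hx
    rw [norm_pos_iff]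
    intro h0
    have := restrP_apply S x.1 v
    rw [h0, if_pos ((hSmem v).2 hv)] at this
    exact hxv this.symm
  have hfix : ∀ x ∈ L.subSpace κ F, restrP S x.1 = x.1 := by
    rintro x ⟨s, hs, hxs⟩
    ext v
    rw [restrP_apply]
    split_ifs with h
    · rfl
    · by_contra hne
      exact h (hsub.2 s hs {v} (by simpa using hxs v (Ne.symm hne))
        (Finset.singleton_nonempty v))
  have hsubost : L.subSpace κ F ⊆ L.ost κ F := by
    rintro x ⟨s, hs, hxs⟩
    obtain ⟨v, hv⟩ := exists_ne_zero L hκ x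
    exact (mem_ost_iff L hκ F hsub x).2 ⟨v, hsub.2 s hs {v} (by simpa using hxs v hv)
        (Finset.singleton_nonempty v), hv⟩
  let h : L.ost κ F × unitInterval → lp (fun _ : V => ℝ) 1 := fun q =>
    (1 - (q.2 : ℝ)) • q.1.1.1 + ((q.2 : ℝ) * (κ / ‖restrP S q.1.1.1‖)) • restrP S q.1.1.1
  have happ : ∀ q v, h q v = (1 - (q.2 : ℝ)) * q.1.1.1 v +
      ((q.2 : ℝ) * (κ / ‖restrP S q.1.1.1‖)) * restrP S q.1.1.1 v := fun q v => rfl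
  have hsupp : ∀ q v, h q v ≠ 0 → q.1.1.1 v ≠ 0 := by
    intro q v hq h0
    apply hq
    rw [happ, restrP_apply, h0]
    simp
  have hmem : ∀ q, h q ∈ L.space κ := by
    intro q
    have hp := hpos q.1.1 q.1.2
    have ht0 := q.2.2.1
    have ht1 : 0 ≤ 1 - (q.2 : ℝ) := sub_nonneg.2 q.2.2.2
    refine ⟨fun v => ?_, ?_, ?_⟩
    · rw [happ]
      have h1 := q.1.1.2.1 v
      have h2 := hnn q.1.1 v
      positivity
    · obtain ⟨s, hs, hxs⟩ := q.1.1.2.2.1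
      exact ⟨s, hs, fun v hv => hxs v (hsupp q v hv)⟩
    · have h1 := q.1.1.2.2.2.mul_left (1 - (q.2 : ℝ))
      have h2 := (hasSum_norm_of_nonneg _ (hnn q.1.1)).mul_left
        ((q.2 : ℝ) * (κ / ‖restrP S q.1.1.1‖))
      have h3 := h1.add h2
      have e : (1 - (q.2 : ℝ)) * κ + (q.2 : ℝ) * (κ / ‖restrP S q.1.1.1‖) *
          ‖restrP S q.1.1.1‖ = κ := by
        field_simp
        ring
      rw [e] at h3
      exact h3
  have hcont : Continuous h := by
    have c1 : Continuous (fun q : L.ost κ F × unitInterval => q.1.1.1) := by fun_prop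
    have c2 : Continuous (fun q : L.ost κ F × unitInterval => restrP S q.1.1.1) :=
      (restrP S).continuous.comp c1
    have c3 : Continuous (fun q : L.ost κ F × unitInterval => (q.2 : ℝ)) := by fun_prop
    exact ((continuous_const.sub c3).smul c1).add
      ((c3.mul (continuous_const.div c2.norm (fun q => (hpos q.1.1 q.1.2).ne'))).smul c2)
  refine ⟨hsubost, ⟨fun q => ⟨h q, hmem q⟩, hcont.subtype_mk hmem⟩, ?_, ?_, ?_, ?_⟩
  · intro b
    apply Subtype.ext
    simp [h]
  · intro b
    have hS1 : ∀ v, h (b, 1) v ≠ 0 → v ∈ S := by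
      intro v hv
      by_contra hn
      apply hv
      rw [happ, restrP_apply, if_neg hn]
      simp
    obtain ⟨s, hs, hxs⟩ := (hmem (b, 1)).2.1
    obtain ⟨w, hw⟩ := exists_ne_zero L hκ ⟨h (b, 1), hmem (b, 1)⟩
    refine ⟨s.filter (fun v => h (b, 1) v ≠ 0), ?_, fun v hv =>
      Finset.mem_filter.2 ⟨hxs v hv, hv⟩⟩
    refine hfull _ (L.down_closed s hs _ (Finset.filter_subset _ _)
        ⟨w, Finset.mem_filter.2 ⟨hxs w hw, hw⟩⟩) (fun v hv => ?_)
    exact hS1 v (Finset.mem_filter.1 hv).2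
  · intro b t
    rw [mem_ost_iff L hκ F hsub]
    obtain ⟨v, hv, hxv⟩ := (mem_ost_iff L hκ F hsub b.1).1 b.2
    refine ⟨v, hv, ?_⟩
    change h (b, t) v ≠ 0
    have hp := hpos b.1 b.2
    have ht0 : 0 ≤ (t : ℝ) := t.2.1
    have ht1 : 0 ≤ 1 - (t : ℝ) := sub_nonneg.2 t.2.2
    have hx : 0 < b.1.1 v := lt_of_le_of_ne (b.1.2.1 v) (Ne.symm hxv)
    rw [happ, restrP_apply, if_pos ((hSmem v).2 hv), ← add_mul]
    refine (mul_pos ?_ hx).ne'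
    change 0 < 1 - (t : ℝ) + t * (κ / ‖restrP S b.1.1‖)
    have hc : 0 < κ / ‖restrP S b.1.1‖ := div_pos hκ hp
    rcases ht0.eq_or_lt with h0 | h0
    · rw [← h0]
      simp
    · exact add_pos_of_nonneg_of_pos ht1 (mul_pos h0 hc)
  · intro b hb
    apply Subtype.ext
    have hn : ‖b.1.1‖ = κ := (hasSum_norm_of_nonneg b.1.1 b.1.2.1).unique b.1.2.2.2
    simp [h, hfix b.1 hb, hn, hκ.ne']
end
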